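/- arXiv:0811.3004 — 6 statements merged into one kernel-verified Lean document; each statement's English description precedes it below -/
import Mathlib

section
/- Let F be a characteristic-zero differential field whose field of constants C is algebraically closed, and let E ⊇ F be a no-new-constants differential field extension. Let x_1,…,x_n ∈ E satisfy x_i′ ∈ F for all i, and let e_1,…,e_m ∈ E ∖ {0} satisfy e_j′/e_j ∈ F for all j. Then either the elements x_1,…,x_n, e_1,…,e_m are algebraically independent over F, or there exists (c_1,…,c_n) ∈ C^n ∖ {0} with Σ_{i=1}^n c_i·x_i ∈ F, or there exists (r_1,…,r_m) ∈ ℤ^m ∖ {0} with Π_{j=1}^m e_j^{r_j} ∈ F (the Kolchin–Ostrowski theorem). -/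
/-- A derivation on a field: an additive map satisfying the Leibniz rule. -/
structure IsDerivation {E : Type*} [Field E] (D : E → E) : Prop where
  map_add : ∀ a b : E, D (a + b) = D a + D b
  leibniz : ∀ a b : E, D (a * b) = D a * b + a * D b

open MvPolynomial in
/-- Apply a map to all coefficients of a polynomial. -/
noncomputable def koCoeffMap {F : Type*} [Field F] {n : ℕ} (d : Derivation ℤ F F)
    (P : MvPolynomial (Fin n) F) : MvPolynomial (Fin n) F :=
  ∑ α ∈ P.support, monomial α (d (coeff α P))

open MvPolynomial in
/-- The derivation on the polynomial ring sending `X i` to `a i`. -/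
noncomputable def koDelta {F : Type*} [Field F] {n : ℕ} (d : Derivation ℤ F F) (a : Fin n → F)
    (P : MvPolynomial (Fin n) F) : MvPolynomial (Fin n) F :=
  koCoeffMap d P + ∑ i, C (a i) * pderiv i P

section
open MvPolynomial
variable {F : Type*} [Field F] {n : ℕ} (d : Derivation ℤ F F) (a : Fin n → F)

lemma ko_coeffMap_coeff (P : MvPolynomial (Fin n) F) (α : Fin n →₀ ℕ) :
    coeff α (koCoeffMap d P) = d (coeff α P) := by
  classical
  unfold koCoeffMap
  rw [coeff_sum]
  simp only [coeff_monomial]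
  rw [Finset.sum_ite_eq']
  split_ifs with h
  · rfl
  · rw [notMem_support_iff.mp h, map_zero]

lemma ko_delta_coeff (P : MvPolynomial (Fin n) F) (α : Fin n →₀ ℕ) :
    coeff α (koDelta d a P) = d (coeff α P) +
      ∑ i, a i * (coeff (α + Finsupp.single i 1) P * (α i + 1)) := by
  unfold koDelta
  simp [coeff_add, coeff_sum, coeff_C_mul, coeff_pderiv, ko_coeffMap_coeff]

lemma ko_delta_add (P Q : MvPolynomial (Fin n) F) :
    koDelta d a (P + Q) = koDelta d a P + koDelta d a Q := by
  ext α
  simp only [ko_delta_coeff, coeff_add, map_add, add_mul, mul_add, Finset.sum_add_distrib]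
  ring

lemma ko_delta_C (c : F) : koDelta d a (C c) = C (d c) := by
  classical
  have : koCoeffMap d (C c : MvPolynomial (Fin n) F) = C (d c) := by
    ext α
    rw [ko_coeffMap_coeff, coeff_C, coeff_C]
    split_ifs <;> simp
  simp [koDelta, this]

lemma ko_delta_mul_X (P : MvPolynomial (Fin n) F) (i : Fin n) :
    koDelta d a (P * X i) = koDelta d a P * X i + C (a i) * P := by
  classical
  have h : koCoeffMap d (P * X i) = koCoeffMap d P * X i := by
    ext α
    rw [ko_coeffMap_coeff, coeff_mul_X', coeff_mul_X', ko_coeffMap_coeff]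
    split_ifs <;> simp
  have h2 : ∑ j, C (a j) * pderiv j (P * X i) =
      (∑ j, C (a j) * pderiv j P) * X i + C (a i) * P := by
    have : ∀ j, C (a j) * pderiv j (P * X i) =
        C (a j) * pderiv j P * X i + (if j = i then C (a j) * P else 0) := by
      intro j
      rw [pderiv_mul]
      by_cases hj : j = i
      · subst hj; simp; ring
      · rw [pderiv_X_of_ne (Ne.symm hj)]; simp [hj]; ring
    simp only [this, Finset.sum_add_distrib, Finset.sum_mul]
    simp
  rw [koDelta, koDelta, h, h2]; ring

lemma ko_delta_C_mul (c : F) (P : MvPolynomial (Fin n) F) :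
    koDelta d a (C c * P) = C (d c) * P + C c * koDelta d a P := by
  ext α
  simp only [ko_delta_coeff, coeff_add, coeff_C_mul, Derivation.leibniz, smul_eq_mul, mul_add,
    Finset.mul_sum]
  have : ∀ i, a i * (c * coeff (α + Finsupp.single i 1) P * (α i + 1)) =
    c * (a i * (coeff (α + Finsupp.single i 1) P * (α i + 1))) := fun i => by ring
  simp only [mul_add, mul_one] at this ⊢
  simp only [this]
  ring

lemma ko_delta_pderiv (P : MvPolynomial (Fin n) F) (j : Fin n) :
    koDelta d a (pderiv j P) = pderiv j (koDelta d a P) := by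
  classical
  ext α
  rw [coeff_pderiv]
  simp only [ko_delta_coeff, coeff_pderiv, add_mul, Finset.sum_mul]
  congr 1
  · rw [mul_comm, Derivation.leibniz]
    have : d ((α j : F) + 1) = 0 := by
      rw [map_add, Derivation.map_natCast, Derivation.map_one_eq_zero, add_zero]
    rw [this]; simp [mul_comm]
  · refine Finset.sum_congr rfl fun i _ => ?_
    rw [add_right_comm α]
    by_cases h : i = j
    · subst h; ring
    · have h' := Ne.symm h
      simp [h, h']; ring

lemma ko_aeval_delta {E : Type*} [Field E] [Algebra F E] (D : Derivation ℤ E E)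
    (hd : ∀ b, algebraMap F E (d b) = D (algebraMap F E b))
    (x : Fin n → E) (hx : ∀ i, D (x i) = algebraMap F E (a i)) (P : MvPolynomial (Fin n) F) :
    aeval x (koDelta d a P) = D (aeval x P) := by
  induction P using MvPolynomial.induction_on with
  | C c => rw [ko_delta_C]; simp [hd]
  | add p q hp hq => rw [ko_delta_add, map_add, hp, hq, map_add, map_add]
  | mul_X p i hp =>
    rw [ko_delta_mul_X]
    simp only [map_add, map_mul, aeval_X, aeval_C, hp, Derivation.leibniz, hx, smul_eq_mul]
    ring

variable {E : Type*} [Field E] [CharZero E] [Algebra F E] (D : Derivation ℤ E E)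

lemma ko_const_aux
    (hd : ∀ b, algebraMap F E (d b) = D (algebraMap F E b))
    (hN : ∀ y : E, D y = 0 → ∃ f, algebraMap F E f = y)
    (x : Fin n → E) (hx : ∀ i, D (x i) = algebraMap F E (a i))
    (hlin : ∀ c : Fin n → F, (∀ i, d (c i) = 0) →
      (∃ f, algebraMap F E f = ∑ i, algebraMap F E (c i) * x i) → c = 0)
    (N : ℕ) : ∀ P : MvPolynomial (Fin n) F,
    (∀ α : Fin n →₀ ℕ, N < α.degree → coeff α P = 0) → koDelta d a P = 0 →
    ∃ c, P = C c := by
  classical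
  have hF0 : CharZero F := (algebraMap F E).charZero_iff (algebraMap F E).injective |>.mpr inferInstance
  induction N with
  | zero =>
    intro P hP _
    refine ⟨coeff 0 P, ?_⟩
    ext α
    rw [coeff_C]
    split_ifs with h
    · rw [h]
    · apply hP
      rw [Nat.pos_iff_ne_zero]
      intro h'
      exact h ((Finsupp.degree_eq_zero_iff _).mp h').symm
  | succ N ih =>
    intro P hP hδ
    have h1 : ∀ i, ∃ c, pderiv i P = C c := by
      intro i
      apply ih
      · intro α hα
        rw [coeff_pderiv, hP, zero_mul]
        simp only [map_add, Finsupp.degree_single]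
        omega
      · rw [ko_delta_pderiv, hδ, map_zero]
    choose c hc using h1
    have hdc : ∀ i, d (c i) = 0 := by
      intro i
      have : koDelta d a (pderiv i P) = 0 := by rw [ko_delta_pderiv, hδ, map_zero]
      rw [hc, ko_delta_C] at this
      exact C_eq_zero.mp this
    have hco : ∀ i (α : Fin n →₀ ℕ), coeff (α + Finsupp.single i 1) P * (α i + 1) =
        if 0 = α then c i else 0 := by
      intro i α
      rw [← coeff_pderiv, hc, coeff_C]
    have h0 : d (coeff 0 P) + ∑ i, a i * c i = 0 := by
      have := ko_delta_coeff d a P 0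
      rw [hδ, coeff_zero] at this
      rw [this]
      congr 1
      refine Finset.sum_congr rfl fun i _ => ?_
      rw [hco, if_pos rfl]
    have hc0 : c = 0 := by
      apply hlin c hdc
      obtain ⟨f, hf⟩ := hN (algebraMap F E (coeff 0 P) + ∑ i, algebraMap F E (c i) * x i) (by
        rw [map_add, ← hd, map_sum]
        have : ∀ i, D (algebraMap F E (c i) * x i) = algebraMap F E (a i * c i) := by
          intro i
          rw [Derivation.leibniz, ← hd, hdc, hx]
          simp [mul_comm]
        simp only [this]
        rw [← map_sum, ← map_add, h0, map_zero])
      exact ⟨f - coeff 0 P, by rw [map_sub, hf]; ring⟩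
    refine ⟨coeff 0 P, ?_⟩
    ext α
    rw [coeff_C]
    split_ifs with h
    · rw [h]
    · obtain ⟨i, hi⟩ : ∃ i, α i ≠ 0 := by
        by_contra hcon
        push Not at hcon
        exact h (Finsupp.ext fun i => (hcon i).symm)
      have h2 := hco i (α - Finsupp.single i 1)
      have h3 : α - Finsupp.single i 1 + Finsupp.single i 1 = α := by
        apply tsub_add_cancel_of_le
        rw [Finsupp.single_le_iff]; omega
      rw [h3, hc0] at h2
      simp only [Pi.zero_apply, ite_self] at h2
      rcases mul_eq_zero.mp h2 with h4 | h4
      · exact h4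
      · exact absurd h4 (Nat.cast_add_one_ne_zero _)

lemma ko_const
    (hd : ∀ b, algebraMap F E (d b) = D (algebraMap F E b))
    (hN : ∀ y : E, D y = 0 → ∃ f, algebraMap F E f = y)
    (x : Fin n → E) (hx : ∀ i, D (x i) = algebraMap F E (a i))
    (hlin : ∀ c : Fin n → F, (∀ i, d (c i) = 0) →
      (∃ f, algebraMap F E f = ∑ i, algebraMap F E (c i) * x i) → c = 0)
    (P : MvPolynomial (Fin n) F) (h : koDelta d a P = 0) : ∃ c, P = C c := by
  refine ko_const_aux d a D hd hN x hx hlin P.totalDegree P ?_ h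
  intro α hα
  by_contra h'
  have := le_totalDegree (mem_support_iff.mpr h')
  rw [Finsupp.degree_eq_sum] at hα
  rw [Finsupp.sum_fintype _ _ (fun _ => rfl)] at this
  omega

lemma ko_coeff_ge (P : MvPolynomial (Fin n) F) (α : Fin n →₀ ℕ)
    (h : MonomialOrder.lex.toSyn (MonomialOrder.lex.degree P) ≤ MonomialOrder.lex.toSyn α) :
    coeff α (koDelta d a P) = d (coeff α P) := by
  rw [ko_delta_coeff, Finset.sum_eq_zero, add_zero]
  intro i _
  rw [MonomialOrder.coeff_eq_zero_of_lt (m := MonomialOrder.lex), zero_mul, mul_zero]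
  refine lt_of_le_of_lt h ?_
  rw [map_add]
  apply lt_add_of_pos_right
  rw [MonomialOrder.toSyn_lt_iff_ne_zero]
  simp

lemma ko_const_exp
    (hd : ∀ b, algebraMap F E (d b) = D (algebraMap F E b))
    (hN : ∀ y : E, D y = 0 → ∃ f, algebraMap F E f = y)
    (x : Fin n → E) (hx : ∀ i, D (x i) = algebraMap F E (a i))
    (hlin : ∀ c : Fin n → F, (∀ i, d (c i) = 0) →
      (∃ f, algebraMap F E f = ∑ i, algebraMap F E (c i) * x i) → c = 0)
    (P : MvPolynomial (Fin n) F) (p : F) (h : koDelta d a P = C p * P) :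
    ∃ c, P = C c := by
  by_cases hP : P = 0
  · exact ⟨0, by simp [hP]⟩
  set l := MonomialOrder.lex.leadingCoeff P with hl
  have hl0 : l ≠ 0 := MonomialOrder.leadingCoeff_ne_zero_iff.mpr hP
  have h1 := ko_coeff_ge d a P (MonomialOrder.lex.degree P) le_rfl
  rw [h, coeff_C_mul] at h1
  change p * l = d l at h1
  have h2 : koDelta d a (C l⁻¹ * P) = 0 := by
    rw [ko_delta_C_mul, h, ← mul_assoc, ← C_mul, ← add_mul, ← C_add, Derivation.leibniz_inv,
      ← h1]
    have : -l⁻¹ ^ 2 • (p * l) + l⁻¹ * p = 0 := by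
      simp only [smul_eq_mul]; field_simp; ring
    rw [this]; simp
  obtain ⟨c, hc⟩ := ko_const d a D hd hN x hx hlin _ h2
  refine ⟨l * c, ?_⟩
  rw [C_mul, ← hc, ← mul_assoc, ← C_mul, mul_inv_cancel₀ hl0]; simp

lemma ko_key
    (hd : ∀ b, algebraMap F E (d b) = D (algebraMap F E b))
    (hN : ∀ y : E, D y = 0 → ∃ f, algebraMap F E f = y)
    (x : Fin n → E) (hx : ∀ i, D (x i) = algebraMap F E (a i))
    (hlin : ∀ c : Fin n → F, (∀ i, d (c i) = 0) →
      (∃ f, algebraMap F E f = ∑ i, algebraMap F E (c i) * x i) → c = 0)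
    {ι : Type*} [DecidableEq ι] (u : ι → E) (hu0 : ∀ β, u β ≠ 0) (b : ι → F)
    (hu : ∀ β, D (u β) = algebraMap F E (b β) * u β)
    (hind : ∀ β γ, β ≠ γ → ∀ f, algebraMap F E f ≠ u β / u γ) (s : Finset ι) :
    ∀ (t : MonomialOrder.lex.syn (σ := Fin n)) (Q : ι → MvPolynomial (Fin n) F) (β₀ : ι), β₀ ∈ s → Q β₀ ≠ 0 →
      MonomialOrder.lex.toSyn (MonomialOrder.lex.degree (Q β₀)) = t →
      ∑ β ∈ s, aeval x (Q β) * u β = 0 → False := by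
  induction s using Finset.strongInduction with
  | H s ihs =>
  intro t
  induction t using WellFoundedLT.induction with
  | ind t iht =>
  intro Q₀ β₀ hβ₀ hQ₀ ht hrel₀
  set l := MonomialOrder.lex.leadingCoeff (Q₀ β₀) with hl
  have hl0 : l ≠ 0 := MonomialOrder.leadingCoeff_ne_zero_iff.mpr hQ₀
  have hlt : ∀ P : MvPolynomial (Fin n) F, P ≠ 0 →
      (∀ α, t ≤ MonomialOrder.lex.toSyn α → coeff α P = 0) →
      MonomialOrder.lex.toSyn (MonomialOrder.lex.degree P) < t := by
    intro P hP h
    by_contra hcon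
    exact MonomialOrder.coeff_degree_ne_zero_iff.mpr hP (h _ (not_lt.mp hcon))
  obtain ⟨Q, hQ⟩ : ∃ Q : ι → MvPolynomial (Fin n) F, ∀ β, Q β = C l⁻¹ * Q₀ β := ⟨_, fun _ => rfl⟩
  have hrel : ∑ β ∈ s, aeval x (Q β) * u β = 0 := by
    simp only [hQ, map_mul, mul_assoc]
    rw [← Finset.mul_sum, hrel₀, mul_zero]
  have hQne : Q β₀ ≠ 0 := by
    rw [hQ]; exact mul_ne_zero (by simpa using hl0) hQ₀
  have hδQ : ∀ α, t ≤ MonomialOrder.lex.toSyn α → coeff α (koDelta d a (Q β₀)) = 0 := by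
    intro α hα
    have hdeg : MonomialOrder.lex.toSyn (MonomialOrder.lex.degree (Q β₀)) ≤ t := by
      rw [hQ, ← ht, MonomialOrder.degree_mul (by simpa using hl0) hQ₀]; simp
    rw [ko_coeff_ge d a _ _ (hdeg.trans hα), hQ, coeff_C_mul]
    rcases hα.eq_or_lt with h | h
    · rw [← ht] at h
      have := MonomialOrder.lex.toSyn.injective h
      rw [← this]
      change d (l⁻¹ * l) = 0
      rw [inv_mul_cancel₀ hl0]; simp
    · rw [← ht] at h
      rw [MonomialOrder.coeff_eq_zero_of_lt h]; simp
  obtain ⟨R, hR⟩ : ∃ R : ι → MvPolynomial (Fin n) F,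
    ∀ β, R β = koDelta d a (Q β) + C (b β - b β₀) * Q β := ⟨_, fun _ => rfl⟩
  have hRrel : ∑ β ∈ s, aeval x (R β) * u β = 0 := by
    have h1 : D (∑ β ∈ s, aeval x (Q β) * u β) - algebraMap F E (b β₀) *
      (∑ β ∈ s, aeval x (Q β) * u β) = 0 := by rw [hrel]; simp
    rw [← h1, map_sum, Finset.mul_sum, ← Finset.sum_sub_distrib]
    refine Finset.sum_congr rfl fun β _ => ?_
    rw [hR, map_add, ko_aeval_delta d a D hd x hx, Derivation.leibniz, hu, map_mul, aeval_C,
      map_sub]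
    simp only [smul_eq_mul]; ring
  have hR0 : R β₀ = koDelta d a (Q β₀) := by rw [hR]; simp
  by_cases hz : R β₀ = 0
  · have hRz : ∀ γ ∈ s, R γ = 0 := by
      intro γ hγ
      by_contra hne
      have hγ' : γ ∈ s.erase β₀ := Finset.mem_erase.mpr ⟨fun h => hne (h ▸ hz), hγ⟩
      refine ihs _ (Finset.erase_ssubset hβ₀) _ R γ hγ' hne rfl ?_
      rw [← Finset.add_sum_erase _ _ hβ₀, hz] at hRrel
      simpa using hRrel
    have hcst : ∀ γ ∈ s, ∃ c, Q γ = C c := by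
      intro γ hγ
      refine ko_const_exp d a D hd hN x hx hlin (Q γ) (-(b γ - b β₀)) ?_
      have := hRz γ hγ
      rw [hR] at this
      rw [C_neg, neg_mul]
      exact eq_neg_of_add_eq_zero_left this
    by_cases hex : ∃ γ ∈ s, γ ≠ β₀ ∧ Q γ ≠ 0
    · obtain ⟨γ, hγ, hne, hQγ⟩ := hex
      obtain ⟨c, hc⟩ := hcst γ hγ
      have hc0 : c ≠ 0 := by rintro rfl; exact hQγ (by simp [hc])
      have h1 := hRz γ hγ
      rw [hR, hc, ko_delta_C, ← C_mul, ← C_add, C_eq_zero] at h1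
      have h2 : D (algebraMap F E c) = - (algebraMap F E (b γ) - algebraMap F E (b β₀)) *
          algebraMap F E c := by
        rw [← hd, eq_neg_of_add_eq_zero_left h1]; simp; ring
      obtain ⟨f, hf⟩ := hN (algebraMap F E c * (u γ / u β₀)) (by
        rw [Derivation.leibniz, Derivation.leibniz_div, hu, hu, h2]
        have := hu0 β₀
        simp only [smul_eq_mul]
        field_simp
        ring)
      refine hind γ β₀ hne (c⁻¹ * f) ?_
      rw [map_mul, hf, map_inv₀, inv_mul_cancel_left₀]
      simpa using hc0
    · push Not at hex
      rw [Finset.sum_eq_single β₀ (fun γ hγ hne => by rw [hex γ hγ hne]; simp)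
        (fun h => absurd hβ₀ h)] at hrel
      obtain ⟨c, hc⟩ := hcst β₀ hβ₀
      have hc0 : c ≠ 0 := by rintro rfl; exact hQne (by simp [hc])
      rw [hc, aeval_C] at hrel
      rcases mul_eq_zero.mp hrel with h | h
      · exact hc0 (by simpa using h)
      · exact hu0 _ h
  · refine iht _ (hlt (R β₀) hz ?_) R β₀ hβ₀ hz rfl hRrel
    rw [hR0]; exact hδQ

end

/-- **The Kolchin–Ostrowski theorem.**  Let `F` be a characteristic-zero differential
field whose field of constants `C` is algebraically closed, and let `E ⊇ F` be a
no-new-constants differential field extension.  If `x₁, …, xₙ ∈ E` satisfy `xᵢ' ∈ F`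
and `e₁, …, eₘ ∈ E \ {0}` satisfy `eⱼ'/eⱼ ∈ F`, then either the `xᵢ` and `eⱼ` are
jointly algebraically independent over `F`, or some nontrivial `C`-linear combination
`Σ cᵢ xᵢ` lies in `F`, or some nontrivial power product `Π eⱼ^{rⱼ}` lies in `F`. -/
theorem kolchin_ostrowski
    {E : Type*} [Field E] [CharZero E]
    (D : E → E) (hD : IsDerivation D)
    (F : Subfield E) (hF : ∀ a ∈ F, D a ∈ F)
    (C : Subfield E) (hC : ∀ c : E, c ∈ C ↔ (c ∈ F ∧ D c = 0))
    [IsAlgClosed C]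
    (hNNC : ∀ a : E, D a = 0 → a ∈ F)
    {n m : ℕ} (x : Fin n → E) (hx : ∀ i, D (x i) ∈ F)
    (e : Fin m → E) (he0 : ∀ j, e j ≠ 0) (he : ∀ j, D (e j) / e j ∈ F) :
    AlgebraicIndependent F (Sum.elim x e) ∨
      (∃ c : Fin n → E, (∀ i, c i ∈ C) ∧ c ≠ 0 ∧ (∑ i, c i * x i) ∈ F) ∨
      (∃ r : Fin m → ℤ, r ≠ 0 ∧ (∏ j, e j ^ r j) ∈ F) := by
  classical
  by_contra hcon
  push Not at hcon
  obtain ⟨hnot, hlin, hexp⟩ := hcon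
  apply hnot
  let D' : Derivation ℤ E E := Derivation.mk' (AddMonoidHom.mk' D hD.map_add).toIntLinearMap (by
    intro a b
    change D (a * b) = a • D b + b • D a
    rw [hD.leibniz]; simp only [smul_eq_mul]; ring)
  have hD' : ∀ y, D' y = D y := fun _ => rfl
  let d : Derivation ℤ F F := Derivation.mk'
    (AddMonoidHom.mk' (fun a : F => (⟨D a, hF a a.2⟩ : F))
      (fun a b => Subtype.ext (hD.map_add a b))).toIntLinearMap (by
    intro a b
    apply Subtype.ext
    change D (a * b) = a * D b + b * D a
    rw [hD.leibniz]; ring)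
  have hd : ∀ b, algebraMap F E (d b) = D' (algebraMap F E b) := fun _ => rfl
  let u : (Fin m →₀ ℕ) → E := fun β => ∏ j, e j ^ β j
  have hu0 : ∀ β, u β ≠ 0 := fun β => Finset.prod_ne_zero_iff.mpr fun j _ => pow_ne_zero _ (he0 j)
  let b : (Fin m →₀ ℕ) → F := fun β => ∑ j, (β j : F) * ⟨D (e j) / e j, he j⟩
  have hu : ∀ β, D' (u β) = algebraMap F E (b β) * u β := by
    intro β
    let _ : Differential E := ⟨D'⟩
    have h1 := Differential.logDeriv_prod (Fin m) Finset.univ (fun j => e j ^ β j)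
      (fun j _ => pow_ne_zero _ (he0 j))
    have h2 : D' (u β) / u β = algebraMap F E (b β) := by
      refine Eq.trans h1 ?_
      rw [map_sum]
      refine Finset.sum_congr rfl fun j _ => ?_
      rw [Differential.logDeriv_pow, map_mul, map_natCast]
      rfl
    rw [← h2, div_mul_cancel₀ _ (hu0 β)]
  rw [algebraicIndependent_iff]
  intro p hp
  let q := MvPolynomial.sumAlgEquiv F (Fin m) (Fin n) (MvPolynomial.rename Sum.swap p)
  have hq : ∀ p : MvPolynomial (Fin n ⊕ Fin m) F,
      MvPolynomial.eval₂ (MvPolynomial.aeval x : MvPolynomial (Fin n) F →ₐ[F] E).toRingHom e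
      (MvPolynomial.sumAlgEquiv F (Fin m) (Fin n) (MvPolynomial.rename Sum.swap p)) =
      MvPolynomial.aeval (Sum.elim x e) p := by
    intro p
    induction p using MvPolynomial.induction_on with
    | C c => simp
    | add p q hp hq => simp only [map_add, MvPolynomial.eval₂_add, hp, hq]
    | mul_X p i hp =>
      simp only [map_mul, MvPolynomial.eval₂_mul, hp]
      rcases i with i | i <;> simp
  by_contra hp0
  have hq0 : q ≠ 0 := by
    intro h
    apply hp0
    have h1 := (MvPolynomial.sumAlgEquiv F (Fin m) (Fin n)).injective (h.trans (map_zero _).symm)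
    exact MvPolynomial.rename_injective _ Sum.swap_leftInverse.injective (h1.trans (map_zero _).symm)
  have hqe := hq p
  rw [hp, MvPolynomial.eval₂_eq'] at hqe
  obtain ⟨β₀, hβ₀⟩ := MvPolynomial.support_nonempty.mpr hq0
  refine ko_key d (fun i => ⟨D (x i), hx i⟩) D' hd (fun y hy => ⟨⟨y, hNNC y hy⟩, rfl⟩) x
    (fun i => rfl) ?_ u hu0 b hu ?_ q.support _ (fun β => q.coeff β) β₀ hβ₀
    (MvPolynomial.mem_support_iff.mp hβ₀) rfl hqe
  · intro c hc ⟨f, hf⟩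
    by_contra hc0
    refine hlin (fun i => (c i : E)) (fun i => (hC _).mpr ⟨(c i).2, congrArg Subtype.val (hc i)⟩)
      ?_ ?_
    · intro h
      exact hc0 (funext fun i => Subtype.ext (congrFun h i))
    · exact hf ▸ f.2
  · intro β γ hne f hf
    refine hexp (fun j => (β j : ℤ) - γ j) ?_ ?_
    · intro h
      apply hne
      ext j
      have := congrFun h j
      simp only [Pi.zero_apply] at this
      omega
    · have : ∏ j, e j ^ ((β j : ℤ) - γ j) = u β / u γ := by
        simp only [u]
        rw [← Finset.prod_div_distrib]
        refine Finset.prod_congr rfl fun j _ => ?_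
        rw [zpow_sub₀ (he0 j)]; simp
      rw [this, ← hf]
      exact f.2
end

section
/- Let F be a characteristic-zero differential field whose field of constants C is algebraically closed, and let E = F(x_1,…,x_n) be a no-new-constants differential field extension of F, where x_1,…,x_n ∈ E satisfy x_i′ ∈ F and are algebraically independent over F. Then for every u ∈ E there exist t ∈ ℕ and elements D_1,…,D_t of the F-linear span of {x_1,…,x_n} inside E such that F⟨u⟩ = F(D_1,…,D_t), where F⟨u⟩ denotes the differential subfield of E generated by F and u. -/
/-- The smallest subfield containing a set `s` which is closed under the map `D`
(the differential subfield generated by `s`). -/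
def diffSubfieldClosure {E : Type*} [Field E] (D : E → E) (s : Set E) : Subfield E :=
  sInf {L : Subfield E | s ⊆ ↑L ∧ ∀ a ∈ L, D a ∈ L}

open MvPolynomial

/-- coefficientwise application of an additive map -/
noncomputable def coeffMap {σ K : Type*} [Field K] (δ : K →+ K) :
    MvPolynomial σ K →+ MvPolynomial σ K where
  toFun p := ∑ m ∈ p.support, monomial m (δ (coeff m p))
  map_zero' := by simp
  map_add' p q := by
    classical
    have key : ∀ (r : MvPolynomial σ K) (m : σ →₀ ℕ),
        coeff m (∑ m ∈ r.support, monomial m (δ (coeff m r))) = δ (coeff m r) := by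
      intro r m
      rw [coeff_sum]
      simp only [coeff_monomial, Finset.sum_ite_eq']
      split_ifs with h
      · rfl
      · rw [notMem_support_iff.1 h, map_zero]
    ext m
    rw [coeff_add, key, key, key, coeff_add, map_add]

lemma coeff_coeffMap {σ K : Type*} [Field K] (δ : K →+ K) (r : MvPolynomial σ K) (m : σ →₀ ℕ) :
    coeff m (coeffMap δ r) = δ (coeff m r) := by
  classical
  change coeff m (∑ m ∈ r.support, monomial m (δ (coeff m r))) = _
  rw [coeff_sum]
  simp only [coeff_monomial, Finset.sum_ite_eq']
  split_ifs with h
  · rfl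
  · rw [notMem_support_iff.1 h, map_zero]

/-- the total derivation -/
noncomputable def totD {σ K : Type*} [Fintype σ] [Field K] (δ : K →+ K) (v : σ → K)
    (p : MvPolynomial σ K) : MvPolynomial σ K :=
  coeffMap δ p + ∑ i, C (v i) * pderiv i p

lemma totD_mul_X {σ K : Type*} [Fintype σ] [Field K] (δ : K →+ K) (v : σ → K)
    (p : MvPolynomial σ K) (i : σ) :
    totD δ v (p * X i) = totD δ v p * X i + p * C (v i) := by
  classical
  have h1 : coeffMap δ (p * X i) = coeffMap δ p * X i := by
    ext m
    rw [coeff_coeffMap, coeff_mul_X', coeff_mul_X', coeff_coeffMap]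
    split_ifs <;> simp
  have h2 : ∑ j, C (v j) * pderiv j (p * X i) =
      (∑ j, C (v j) * pderiv j p) * X i + p * C (v i) := by
    have : ∀ j, C (v j) * pderiv j (p * X i) =
      (C (v j) * pderiv j p) * X i + (if j = i then p * C (v i) else 0) := by
      intro j
      rw [pderiv_mul, pderiv_X]
      by_cases h : j = i
      · subst h; simp; ring
      · rw [Pi.single_eq_of_ne (Ne.symm h)]; simp [h]; ring
    simp only [this, Finset.sum_add_distrib, Finset.sum_mul]
    simp
  rw [totD, totD, h1, h2]; ring

lemma totD_pderiv {σ K : Type*} [Fintype σ] [Field K] (δ : K →+ K) (v : σ → K)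
    (hδ : ∀ (a : K) (n : ℕ), δ (a * n) = δ a * n)
    (p : MvPolynomial σ K) (i : σ) :
    totD δ v (pderiv i p) = pderiv i (totD δ v p) := by
  classical
  rw [totD, totD, map_add, map_sum]
  congr 1
  · ext m
    rw [coeff_coeffMap, coeff_pderiv, coeff_pderiv, coeff_coeffMap]
    simpa using hδ _ (m i + 1)
  · refine Finset.sum_congr rfl fun j _ => ?_
    rw [pderiv_C_mul]
    congr 1
    ext m
    simp only [coeff_pderiv]
    by_cases h : i = j
    · subst h; rfl
    · have h' : j ≠ i := Ne.symm h
      rw [add_right_comm]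
      simp [h, h']; ring

lemma eval_totD {σ E : Type*} [Fintype σ] [Field E] {D : E → E} (hD : IsDerivation D)
    (K : Subfield E) (δ : K →+ K) (hδ : ∀ a : K, (δ a : E) = D a) (y : σ → E) (v : σ → K)
    (hv : ∀ i, (v i : E) = D (y i)) (p : MvPolynomial σ K) :
    aeval y (totD δ v p) = D (aeval y p) := by
  induction p using MvPolynomial.induction_on with
  | C a =>
    have : coeffMap δ (C a : MvPolynomial σ K) = C (δ a) := by
      classical
      ext m
      rw [coeff_coeffMap, coeff_C, coeff_C]
      split_ifs <;> simp
    simp only [totD, this, pderiv_C, mul_zero, Finset.sum_const_zero, add_zero, algHom_C]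
    exact hδ a
  | add p q hp hq =>
    have : totD δ v (p + q) = totD δ v p + totD δ v q := by
      simp only [totD, map_add, mul_add, Finset.sum_add_distrib]; ring
    rw [this, map_add, map_add, hp, hq, hD.map_add]
  | mul_X p i hp =>
    rw [totD_mul_X, map_add, map_mul, map_mul, map_mul, hp, aeval_X, hD.leibniz, algHom_C]
    congr 2
    exact hv i

lemma deriv_nat {E : Type*} [Field E] {D : E → E} (hD : IsDerivation D) (a : E) (n : ℕ) :
    D (a * n) = D a * n := by
  have h0 : D 0 = 0 := by simpa using hD.map_add 0 0
  induction n with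
  | zero => simp [h0]
  | succ n ih => push_cast; rw [mul_add, mul_add, hD.map_add, ih]; simp

/-- Ostrowski. -/
lemma ostrowski {E : Type*} [Field E] [CharZero E] {D : E → E} (hD : IsDerivation D)
    (K : Subfield E) (hK : ∀ a ∈ K, D a ∈ K) (hc : ∀ a, D a = 0 → a ∈ K)
    {m : ℕ} (y : Fin m → E) (hy : ∀ i, D (y i) ∈ K)
    (hli : ∀ c : Fin m → E, (∀ i, D (c i) = 0) → ∑ i, c i * y i ∈ K → ∀ i, c i = 0) :
    AlgebraicIndependent K y := by
  classical
  have h0 : D 0 = 0 := by simpa using hD.map_add 0 0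
  have h1 : D 1 = 0 := by simpa using hD.leibniz 1 1
  let δ : K →+ K :=
    { toFun := fun a => ⟨D a, hK a a.2⟩
      map_zero' := Subtype.ext (by simpa using h0)
      map_add' := fun a b => Subtype.ext (by simpa using hD.map_add a b) }
  have hδ : ∀ a : K, (δ a : E) = D a := fun a => rfl
  have hδn : ∀ (a : K) (n : ℕ), δ (a * n) = δ a * n := fun a n =>
    Subtype.ext (by simpa [hδ] using deriv_nat hD (a : E) n)
  let v : Fin m → K := fun i => ⟨D (y i), hy i⟩
  have hev := eval_totD hD K δ hδ y v (fun i => rfl)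
  let ord : MonomialOrder (Fin m) := MonomialOrder.lex
  rw [algebraicIndependent_iff]
  by_contra! hcon
  let S : Set (MvPolynomial (Fin m) K) := {p | aeval y p = 0 ∧ p ≠ 0}
  have hS : S.Nonempty := hcon
  obtain ⟨P₀, hP₀, hmin₀⟩ := WellFounded.has_min
    (InvImage.wf (fun p : MvPolynomial (Fin m) K => ord.toSyn (ord.degree p))
      (wellFounded_lt (α := ord.syn))) S hS
  -- smaller polynomials vanish
  have small : ∀ q : MvPolynomial (Fin m) K, aeval y q = 0 →
      (∀ b, coeff b q ≠ 0 → ord.toSyn b < ord.toSyn (ord.degree P₀)) → q = 0 := by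
    intro q hq hb
    by_contra hq0
    exact hmin₀ q ⟨hq, hq0⟩ (hb _ (ord.coeff_degree_ne_zero_iff.2 hq0))
  obtain ⟨hP0, hPne⟩ := hP₀
  have hlc : coeff (ord.degree P₀) P₀ ≠ 0 := ord.coeff_degree_ne_zero_iff.2 hPne
  set d := ord.degree P₀ with hd
  obtain ⟨P, hP, hPd, hPle⟩ : ∃ P : MvPolynomial (Fin m) K, aeval y P = 0 ∧ coeff d P = 1 ∧
      ∀ b, coeff b P ≠ 0 → ord.toSyn b ≤ ord.toSyn d := by
    refine ⟨C (coeff d P₀)⁻¹ * P₀, by rw [map_mul, hP0, mul_zero], ?_, ?_⟩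
    · rw [coeff_C_mul, inv_mul_cancel₀ hlc]
    · intro b hb
      rw [coeff_C_mul] at hb
      exact ord.le_degree (mem_support_iff.2 (right_ne_zero_of_mul hb))
  have hlt : ∀ b i, coeff (b + Finsupp.single i 1) P ≠ 0 → ord.toSyn b < ord.toSyn d := by
    intro b i hb
    refine lt_of_lt_of_le (ord.toSyn_strictMono ?_) (hPle _ hb)
    exact lt_add_of_pos_right _ (by rw [pos_iff_ne_zero]; simp)
  have hd0 : d ≠ 0 := by
    intro h
    have : P₀ = C (ord.leadingCoeff P₀) := ord.eq_C_of_degree_eq_zero h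
    rw [this, algHom_C] at hP0
    have h3 : ord.leadingCoeff P₀ = 0 := by
      exact (map_eq_zero (algebraMap K E)).1 hP0
    exact hPne (ord.leadingCoeff_eq_zero_iff.1 h3)
  have hTot : totD δ v P = 0 := by
    apply small
    · rw [hev, hP, h0]
    · intro b hb
      rw [totD, coeff_add, coeff_coeffMap, coeff_sum] at hb
      by_cases h2 : ∃ i, coeff (b + Finsupp.single i 1) P ≠ 0
      · obtain ⟨i, hi⟩ := h2
        exact hlt b i hi
      · push Not at h2
        have : ∑ i, coeff b (C (v i) * pderiv i P) = 0 :=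
          Finset.sum_eq_zero fun i _ => by rw [coeff_C_mul, coeff_pderiv, h2 i]; simp
        rw [this, add_zero] at hb
        have hb1 : coeff b P ≠ 0 := fun h => hb (by rw [h, map_zero])
        refine lt_of_le_of_ne (hPle b hb1) fun h => ?_
        have h' : b = d := ord.toSyn.injective h
        rw [h', hPd] at hb
        exact hb (Subtype.ext (by simpa [hδ] using h1))
  have hcst : ∀ i, D (aeval y (pderiv i P)) = 0 := by
    intro i
    rw [← hev, totD_pderiv δ v hδn, hTot, map_zero, map_zero]
  let c : Fin m → K := fun i => ⟨_, hc _ (hcst i)⟩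
  have hpd : ∀ i, pderiv i P = C (c i) := by
    intro i
    rw [← sub_eq_zero]
    apply small
    · rw [map_sub, algHom_C]; exact sub_self _
    · intro b hb
      by_cases hb0 : b = 0
      · subst hb0
        rw [map_zero]
        exact lt_of_le_of_ne (ord.zero_le _) fun h => hd0 (ord.toSyn_eq_zero_iff _ |>.1 h.symm)
      · rw [coeff_sub, coeff_C, if_neg (Ne.symm hb0), sub_zero, coeff_pderiv] at hb
        exact hlt b i (left_ne_zero_of_mul hb)
  have hPeq : P = C (coeff 0 P) + ∑ i, C (c i) * X i := by
    have hder : ∀ i b, coeff (b + Finsupp.single i 1) P * (b i + 1) = if b = 0 then c i else 0 := by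
      intro i b
      rw [← coeff_pderiv, hpd, coeff_C]
      simp [eq_comm]
    rw [← sub_eq_zero]
    set Q := P - (C (coeff 0 P) + ∑ i, C (c i) * X i) with hQ
    have hQd : ∀ i, pderiv i Q = 0 := by
      intro i
      rw [hQ, map_sub, map_add, map_sum, pderiv_C, hpd, Finset.sum_eq_single i]
      · simp
      · intro j _ hj
        rw [pderiv_C_mul, pderiv_X_of_ne hj, mul_zero]
      · simp
    ext1 b
    by_cases hb0 : b = 0
    · subst hb0
      simp [hQ, coeff_sum]
    · obtain ⟨i, hi⟩ : ∃ i, b i ≠ 0 := by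
        by_contra! h
        exact hb0 (Finsupp.ext h)
      have hle : Finsupp.single i 1 ≤ b := by
        rw [Finsupp.single_le_iff]; omega
      have h4 := congrArg (coeff (b - Finsupp.single i 1)) (hQd i)
      rw [coeff_pderiv, tsub_add_cancel_of_le hle, coeff_zero] at h4
      rw [coeff_zero]
      refine (mul_eq_zero.1 h4).resolve_right ?_
      exact Nat.cast_add_one_ne_zero _
  have hrel : ∑ i, (c i : E) * y i = - (coeff 0 P : K) := by
    have h5 := hP
    rw [hPeq, map_add, map_sum, algHom_C] at h5
    have h6 : ∀ i, aeval y (C (c i) * X i : MvPolynomial (Fin m) K) = (c i : E) * y i := by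
      intro i
      rw [map_mul, algHom_C, aeval_X]; rfl
    simp only [h6] at h5
    exact eq_neg_of_add_eq_zero_right h5
  have hc0 := hli (fun i => c i) hcst (by rw [hrel]; exact neg_mem (Subtype.mem _))
  have hc0' : ∀ i, c i = 0 := fun i => Subtype.ext (hc0 i)
  rw [hPeq] at hPd
  simp only [hc0', map_zero, zero_mul, Finset.sum_const_zero, add_zero, coeff_C] at hPd
  rw [if_neg (Ne.symm hd0)] at hPd
  exact zero_ne_one hPd

lemma sub_eq_of_indep {E : Type*} [Field E] (L K : Subfield E) (hLK : L ≤ K) {m : ℕ}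
    (y : Fin m → E) (hy : AlgebraicIndependent K y)
    (hgen : Subfield.closure (↑L ∪ Set.range y) = ⊤) : K ≤ L := by
  intro a ha
  have hmem : a ∈ IntermediateField.adjoin L (Set.range y) := by
    have : a ∈ Subfield.closure (↑L ∪ Set.range y) := by rw [hgen]; trivial
    have h2 : Set.range (algebraMap L E) = ↑L := Subtype.range_coe
    rw [← IntermediateField.mem_toSubfield, IntermediateField.adjoin_toSubfield, h2]
    exact this
  obtain ⟨r, s, hrs⟩ := (IntermediateField.mem_adjoin_range_iff L y a).1 hmem
  by_cases hs : aeval y s = 0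
  · rw [hrs, hs, div_zero]; exact zero_mem _
  let ι : L →+* K := Subfield.inclusion hLK
  have hι : ∀ p : MvPolynomial (Fin m) L, aeval y (map ι p) = aeval y p := by
    intro p
    rw [aeval_def, eval₂_map, aeval_def]; rfl
  have hz : C (⟨a, ha⟩ : K) * map ι s - map ι r = 0 := by
    apply (algebraicIndependent_iff.1 hy)
    rw [map_sub, map_mul, hι, hι, algHom_C]
    change a * _ - _ = 0
    rw [hrs, div_mul_cancel₀ _ hs, sub_self]
  have hs0 : s ≠ 0 := by rintro rfl; exact hs (map_zero _)
  obtain ⟨b, hb⟩ := ne_zero_iff.1 hs0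
  have h3 := congrArg (coeff b) hz
  rw [coeff_sub, coeff_C_mul, coeff_map, coeff_map, coeff_zero, sub_eq_zero] at h3
  have h4 : a * (coeff b s : L) = (coeff b r : L) := congrArg Subtype.val h3
  have h5 : ((coeff b s : L) : E) ≠ 0 := fun h => hb (Subtype.ext h)
  rw [eq_div_of_mul_eq h5 h4]
  exact div_mem (Subtype.mem _) (Subtype.mem _)

theorem antiderivative_extension_singly_generated_structure
    {E : Type*} [Field E] [CharZero E]
    (D : E → E) (hD : IsDerivation D)
    (F : Subfield E) (hF : ∀ a ∈ F, D a ∈ F)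
    (C : Subfield E) (hC : ∀ c : E, c ∈ C ↔ (c ∈ F ∧ D c = 0))
    [IsAlgClosed C]
    (hNNC : ∀ a : E, D a = 0 → a ∈ F)
    {n : ℕ} (x : Fin n → E) (hx : ∀ i, D (x i) ∈ F)
    (hind : AlgebraicIndependent F x)
    (hgen : Subfield.closure (↑F ∪ Set.range x) = ⊤)
    (u : E) :
    ∃ (t : ℕ) (d : Fin t → E),
      (∀ i, ∃ f : Fin n → E, (∀ j, f j ∈ F) ∧ d i = ∑ j, f j * x j) ∧
      diffSubfieldClosure D (↑F ∪ {u}) = Subfield.closure (↑F ∪ Set.range d) := by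
  have h0 : D 0 = 0 := by simpa using hD.map_add 0 0
  set K := diffSubfieldClosure D (↑F ∪ {u}) with hKdef
  have hFK : F ≤ K := le_sInf fun L hL a ha => hL.1 (Or.inl ha)
  have hKD : ∀ a ∈ K, D a ∈ K := by
    intro a ha
    rw [hKdef, diffSubfieldClosure, Subfield.mem_sInf] at ha ⊢
    exact fun L hL => hL.2 a (ha L hL)
  have hCF : C ≤ F := fun c hc => ((hC c).1 hc).1
  let W : Submodule C E := Submodule.span C (Set.range x)
  let KC : Submodule C E :=
    { carrier := K
      zero_mem' := zero_mem K
      add_mem' := fun ha hb => add_mem ha hb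
      smul_mem' := fun c a ha => mul_mem (hFK (hCF c.2)) ha }
  let U := W ⊓ KC
  obtain ⟨Q, hQ⟩ := Submodule.exists_isCompl U
  let U' := Q ⊓ W
  have hsup : U ⊔ U' = W := by
    have := sup_inf_assoc_of_le Q (inf_le_left : U ≤ W)
    rw [hQ.sup_eq_top, top_inf_eq] at this
    exact this.symm
  have hinf : ∀ a, a ∈ U' → a ∈ K → a = 0 := by
    intro a ha hk
    have : a ∈ U ⊓ Q := ⟨⟨ha.2, hk⟩, ha.1⟩
    rw [hQ.inf_eq_bot] at this
    exact this
  have hWrep : ∀ a ∈ W, ∃ c : Fin n → C, ∑ j, c j • x j = a := fun a ha =>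
    (Submodule.mem_span_range_iff_exists_fun C).1 ha
  have hWD : ∀ a ∈ W, D a ∈ F := by
    intro a ha
    refine Submodule.span_induction (p := fun a _ => D a ∈ F) ?_ ?_ ?_ ?_ ha
    · rintro _ ⟨i, rfl⟩; exact hx i
    · rw [h0]; exact zero_mem _
    · intro a b _ _ h1 h2; rw [hD.map_add]; exact add_mem h1 h2
    · intro c a _ h1
      change D ((c : E) * a) ∈ F
      rw [hD.leibniz, ((hC c).1 c.2).2, zero_mul, zero_add]
      exact mul_mem (hCF c.2) h1
  haveI : FiniteDimensional C W := FiniteDimensional.span_of_finite C (Set.finite_range x)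
  haveI : FiniteDimensional C U := Submodule.finiteDimensional_of_le (inf_le_left : U ≤ W)
  haveI : FiniteDimensional C U' := Submodule.finiteDimensional_of_le (inf_le_right : U' ≤ W)
  let bd := Module.finBasis C U
  let by' := Module.finBasis C U'
  let d : Fin (Module.finrank C U) → E := fun i => (bd i : E)
  let y : Fin (Module.finrank C U') → E := fun i => (by' i : E)
  refine ⟨_, d, ?_, ?_⟩
  · intro i
    obtain ⟨c, hc⟩ := hWrep (d i) (bd i).2.1
    exact ⟨fun j => c j, fun j => hCF (c j).2, hc.symm⟩
  set L := Subfield.closure (↑F ∪ Set.range d) with hL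
  have hFL : F ≤ L := fun a ha => Subfield.subset_closure (Or.inl ha)
  have hLK : L ≤ K := by
    rw [hL, Subfield.closure_le]
    rintro a (ha | ⟨i, rfl⟩)
    · exact hFK ha
    · exact (bd i).2.2
  refine le_antisymm ?_ hLK
  refine sub_eq_of_indep L K hLK y ?_ ?_
  · refine ostrowski hD K hKD (fun a ha => hFK (hNNC a ha)) y
      (fun i => hFK (hWD _ (by' i).2.2)) ?_
    intro c hc hmem
    let c' : Fin (Module.finrank C U') → C := fun i => ⟨c i, (hC _).2 ⟨hNNC _ (hc i), hc i⟩⟩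
    have h1 : ((∑ i, c' i • by' i : U') : E) = ∑ i, c i * y i := by
      rw [Submodule.coe_sum]; rfl
    have h2 : (∑ i, c' i • by' i : U') = 0 := by
      apply Subtype.ext
      exact hinf _ (Subtype.mem _) (by rw [h1]; exact hmem)
    intro i
    exact congrArg Subtype.val (Fintype.linearIndependent_iff.1 by'.linearIndependent c' h2 i)
  · rw [eq_top_iff, ← hgen, Subfield.closure_le]
    set M := Subfield.closure ((L : Set E) ∪ Set.range y) with hM
    have hLM : L ≤ M := fun a ha => Subfield.subset_closure (Or.inl ha)
    rintro a (ha | ⟨i, rfl⟩)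
    · exact hLM (hFL ha)
    · have hxW : x i ∈ U ⊔ U' := by rw [hsup]; exact Submodule.subset_span ⟨i, rfl⟩
      obtain ⟨p, hp, q, hq, hpq⟩ := Submodule.mem_sup.1 hxW
      rw [← hpq]
      refine add_mem ?_ ?_
      · have h := congrArg (Subtype.val) (bd.sum_repr ⟨p, hp⟩)
        rw [Submodule.coe_sum] at h
        change _ = p at h
        rw [← h]
        refine sum_mem fun j _ => ?_
        exact mul_mem (hLM (hFL (hCF (Subtype.mem _))))
          (hLM (Subfield.subset_closure (Or.inr ⟨j, rfl⟩)))
      · have h := congrArg (Subtype.val) (by'.sum_repr ⟨q, hq⟩)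
        rw [Submodule.coe_sum] at h
        change _ = q at h
        rw [← h]
        refine sum_mem fun j _ => ?_
        exact mul_mem (hLM (hFL (hCF (Subtype.mem _))))
          (Subfield.subset_closure (Or.inr ⟨j, rfl⟩))
end

section
/- Let F be a characteristic-zero differential field whose field of constants C is algebraically closed, and let E = F(x_1,…,x_n) be a no-new-constants differential field extension of F, where x_1,…,x_n ∈ E satisfy x_i′ ∈ F and are algebraically independent over F. Then every intermediate field K with F ⊆ K ⊆ E that is closed under the derivation of E is of the form K = F(L_1,…,L_t), where each L_i belongs to the C-linear span of {x_1,…,x_n}, i.e. L_i = Σ_{j=1}^n c_{ij}·x_j with c_{ij} ∈ C. -/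
open MvPolynomial in
/-- The extension of a derivation `d` of `K` to `K[X_i]` with `X_i ↦ f i`, with its coefficients
and its compatibility with evaluation. -/
lemma exists_mvDelta {K E σ : Type*} [Field K] [Field E] [Algebra K E] [Fintype σ]
    (d : K →+ K) (D : E →+ E)
    (hDl : ∀ a b : E, D (a * b) = D a * b + a * D b)
    (hc : ∀ a, D (algebraMap K E a) = algebraMap K E (d a))
    (y : σ → E) (f : σ → K) (hf : ∀ i, D (y i) = algebraMap K E (f i)) :
    ∃ Δ : MvPolynomial σ K → MvPolynomial σ K,
      (∀ P β, coeff β (Δ P) = d (coeff β P) +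
        ∑ i, f i * (coeff (β + Finsupp.single i 1) P * ((β i : K) + 1))) ∧
      (∀ P, aeval y (Δ P) = D (aeval y P)) := by
  classical
  let δ : MvPolynomial σ K → MvPolynomial σ K := fun P => ∑ m ∈ P.support, monomial m (d (coeff m P))
  have hδ : ∀ P β, coeff β (δ P) = d (coeff β P) := by
    intro P β
    simp only [δ, coeff_sum, coeff_monomial, Finset.sum_ite_eq']
    split_ifs with h
    · rfl
    · rw [notMem_support_iff.mp h, map_zero]
  have hδadd : ∀ P Q, δ (P + Q) = δ P + δ Q := by
    intro P Q; ext β; simp [hδ]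
  have hδC : ∀ a, δ (C a) = C (d a) := by
    intro a; ext β; simp only [hδ, coeff_C]; split_ifs <;> simp
  have hδX : ∀ P i, δ (P * X i) = δ P * X i := by
    intro P i; ext β; simp only [hδ, coeff_mul_X']; split_ifs <;> simp
  refine ⟨fun P => δ P + ∑ i, C (f i) * pderiv i P, ?_, ?_⟩
  · intro P β
    simp [hδ, coeff_sum, coeff_C_mul, coeff_pderiv]
  · intro P
    induction P using MvPolynomial.induction_on with
    | C a => simp [hδC, hc]
    | add p q hp hq =>
      simp only [map_add, hδadd] at *
      rw [← hp, ← hq]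
      simp only [mul_add, Finset.sum_add_distrib, map_add]; ring
    | mul_X p i hp =>
      have h2 : ∑ j, C (f j) * pderiv j (p * X i) = (∑ j, C (f j) * pderiv j p) * X i + C (f i) * p := by
        simp only [pderiv_mul, mul_add, Finset.sum_add_distrib, Finset.sum_mul]
        congr 1
        · exact Finset.sum_congr rfl fun _ _ => by ring
        · rw [Finset.sum_eq_single i]
          · simp
          · intro j _ hj
            rw [pderiv_X_of_ne hj.symm]; simp
          · simp
      simp only [hδX, h2]
      rw [map_mul (aeval y), hDl, ← hp]
      simp only [map_add, map_mul, aeval_X, hf, aeval_C]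
      ring

open MvPolynomial in
/-- Kolchin–Ostrowski theorem for antiderivatives. -/
lemma ostrowski_algInd {K E σ : Type*} [Field K] [CharZero K] [Field E] [Algebra K E] [Fintype σ]
    [LinearOrder σ]
    (d : K →+ K) (D : E →+ E) (hd1 : d 1 = 0)
    (hDl : ∀ a b : E, D (a * b) = D a * b + a * D b)
    (hc : ∀ a, D (algebraMap K E a) = algebraMap K E (d a))
    (hconst : ∀ a, D a = 0 → a ∈ Set.range (algebraMap K E))
    (y : σ → E) (f : σ → K) (hf : ∀ i, D (y i) = algebraMap K E (f i))
    (hlin : ∀ c : σ → K, (∀ i, d (c i) = 0) →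
      ∑ i, algebraMap K E (c i) * y i ∈ Set.range (algebraMap K E) → ∀ i, c i = 0) :
    AlgebraicIndependent K y := by
  classical
  obtain ⟨Δ, hΔ, hΔy⟩ := exists_mvDelta d D hDl hc y f hf
  let o : MonomialOrder σ := MonomialOrder.lex
  have hlt : ∀ (β : σ →₀ ℕ) i, o.toSyn β < o.toSyn (β + Finsupp.single i 1) := by
    intro β i
    rw [map_add]
    refine lt_add_of_pos_right _ ?_
    exact o.toSyn_lt_iff_ne_zero.mpr (by simp)
  have hwf : WellFounded (fun P Q : MvPolynomial σ K => o.toSyn (o.degree P) < o.toSyn (o.degree Q)) :=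
    InvImage.wf _ (wellFounded_lt (α := o.syn))
  -- criterion for constancy
  have hcst : ∀ P : MvPolynomial σ K, (∀ γ i, coeff (γ + Finsupp.single i 1) P = 0) →
      P = C (coeff 0 P) := by
    intro P h
    ext β
    rw [coeff_C]
    split_ifs with h0
    · rw [← h0]
    · obtain ⟨i, hi⟩ : ∃ i, β i ≠ 0 := by
        by_contra! hcon
        exact h0 (by ext i; simp [hcon i])
      have hle : Finsupp.single i 1 ≤ β := by
        rw [Finsupp.single_le_iff]; omega
      rw [← tsub_add_cancel_of_le hle]
      exact h _ _
  rw [algebraicIndependent_iff]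
  by_contra! hcon
  -- Step A
  have hA : ∃ P : MvPolynomial σ K, Δ P = 0 ∧ ∀ b, P ≠ C b := by
    obtain ⟨P, ⟨hP0, hP1⟩, hmin⟩ := hwf.has_min {P | aeval y P = 0 ∧ P ≠ 0} hcon
    let l := coeff (o.degree P) P
    have hl : l ≠ 0 := o.coeff_degree_ne_zero_iff.mpr hP1
    let Q := C l⁻¹ * P
    have hQc : ∀ β, coeff β Q = l⁻¹ * coeff β P := fun β => coeff_C_mul _ _ _
    have hQ0 : aeval y Q = 0 := by simp [Q, hP0]
    have hQ1 : coeff (o.degree P) Q = 1 := by rw [hQc]; exact inv_mul_cancel₀ hl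
    have hQne : Q ≠ 0 := by intro h; simp [h] at hQ1
    refine ⟨Q, ?_, ?_⟩
    · by_contra hne
      refine hmin (Δ Q) ⟨by rw [hΔy, hQ0, map_zero], hne⟩ ?_
      by_contra hge
      rw [not_lt] at hge
      have hz : ∀ β, o.toSyn (o.degree P) < o.toSyn β → coeff β Q = 0 := by
        intro β hβ
        rw [hQc, o.coeff_eq_zero_of_lt hβ, mul_zero]
      refine (o.coeff_degree_ne_zero_iff.mpr hne) ?_
      rw [hΔ, Finset.sum_eq_zero, add_zero]
      · rcases hge.lt_or_eq with h | h
        · rw [hz _ h, map_zero]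
        · rw [← o.toSyn.injective h, hQ1, hd1]
      · intro i _
        rw [hz _ (hge.trans_lt (hlt _ i))]; simp
    · intro b hb
      rw [hb, aeval_C] at hQ0
      have : b = 0 := (map_eq_zero _).mp hQ0
      exact hQne (by rw [hb, this, C_0])
  -- Step B
  obtain ⟨P, ⟨hP0, hP1⟩, hmin⟩ := hwf.has_min {P | Δ P = 0 ∧ ∀ b, P ≠ C b} hA
  have hB : ∀ i, ∃ b, pderiv i P = C b := by
    intro i
    by_contra! hne
    have hne0 : pderiv i P ≠ 0 := by simpa using hne 0
    refine hmin (pderiv i P) ⟨?_, hne⟩ ?_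
    · ext β
      have h1 := congrArg (fun R => coeff (β + Finsupp.single i 1) R * ((β i : K) + 1)) hP0
      simp only [hΔ, coeff_zero, zero_mul] at h1
      rw [coeff_zero, hΔ, ← h1, add_mul, Finset.sum_mul]
      simp only [coeff_pderiv]
      congr 1
      · have : ∀ a : K, a * ((β i : K) + 1) = (β i + 1) • a := by intro a; simp [mul_comm]
        rw [this, this, map_nsmul]
      · refine Finset.sum_congr rfl fun j _ => ?_
        rw [add_right_comm β]
        by_cases hij : i = j
        · subst hij; simp; ring
        · have hji : j ≠ i := fun h => hij h.symm
          simp [hij, hji]; ring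
    · have h := o.coeff_degree_ne_zero_iff.mpr hne0
      rw [coeff_pderiv] at h
      exact (hlt _ i).trans_le (o.le_degree (mem_support_iff.mpr (left_ne_zero_of_mul h)))
  have hz : ∀ β i, β ≠ 0 → coeff (β + Finsupp.single i 1) P = 0 := by
    intro β i hβ
    obtain ⟨b, hb⟩ := hB i
    have h := congrArg (coeff β) hb
    rw [coeff_pderiv, coeff_C, if_neg hβ.symm] at h
    exact (mul_eq_zero.mp h).resolve_right (by exact_mod_cast Nat.succ_ne_zero (β i))
  let c : σ → K := fun i => coeff (Finsupp.single i 1) P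
  have hdc : ∀ i, d (c i) = 0 := by
    intro i
    have h := congrArg (coeff (Finsupp.single i 1)) hP0
    rw [hΔ, Finset.sum_eq_zero, add_zero, coeff_zero] at h
    · exact h
    · intro j _
      rw [hz _ _ (by simp)]; simp
  have hPe : P = C (coeff 0 P) + ∑ j, C (c j) * X j := by
    have h := hcst (P - ∑ j, C (c j) * X j) ?_
    · rw [sub_eq_iff_eq_add] at h
      rw [h]
      simp [coeff_sum, coeff_C_mul]
    · intro γ i
      rw [coeff_sub, coeff_sum]
      simp only [coeff_C_mul, coeff_X]
      by_cases hγ : γ = 0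
      · subst hγ
        rw [Finset.sum_eq_single i]
        · simp [c]
        · intro j _ hj
          rw [if_neg, mul_zero]
          intro h
          rw [zero_add] at h
          exact hj (Finsupp.single_left_injective one_ne_zero h)
        · simp
      · rw [hz _ _ hγ, Finset.sum_eq_zero, sub_zero]
        intro j _
        rw [if_neg, mul_zero]
        intro h
        apply hγ
        have h2 := congrArg Finsupp.degree h
        simp at h2
        exact (Finsupp.degree_eq_zero_iff γ).mp h2
  have hconstP := hconst (aeval y P) (by rw [← hΔy, hP0, map_zero])
  obtain ⟨b, hb⟩ := hconstP
  have hc0 := hlin c hdc ⟨b - coeff 0 P, by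
    rw [map_sub, hb]
    have h := congrArg (aeval y) hPe
    rw [h]
    simp only [map_add, map_sum, map_mul, aeval_X, aeval_C]
    ring⟩
  refine hP1 (coeff 0 P) ?_
  conv_lhs => rw [hPe]
  simp [hc0]

/-- Let `E = F(x₁,…,xₙ)` be a no-new-constants differential field extension of a
characteristic-zero differential field `F` with algebraically closed field of
constants `C`, where the `xᵢ` are algebraically independent antiderivatives of `F`.
Then every intermediate field `F ⊆ K ⊆ E` which is closed under the derivation is
generated over `F` by finitely many `C`-linear combinations of `x₁, …, xₙ`. -/
theorem antiderivative_extension_intermediate_field_structure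
    {E : Type*} [Field E] [CharZero E]
    (D : E → E) (hD : IsDerivation D)
    (F : Subfield E) (hF : ∀ a ∈ F, D a ∈ F)
    (C : Subfield E) (hC : ∀ c : E, c ∈ C ↔ (c ∈ F ∧ D c = 0))
    [IsAlgClosed C]
    (hNNC : ∀ a : E, D a = 0 → a ∈ F)
    {n : ℕ} (x : Fin n → E) (hx : ∀ i, D (x i) ∈ F)
    (hind : AlgebraicIndependent F x)
    (hgen : Subfield.closure (↑F ∪ Set.range x) = ⊤)
    (K : Subfield E) (hFK : F ≤ K) (hK : ∀ a ∈ K, D a ∈ K) :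
    ∃ (t : ℕ) (L : Fin t → E),
      (∀ i, ∃ c : Fin n → E, (∀ j, c j ∈ C) ∧ L i = ∑ j, c j * x j) ∧
      K = Subfield.closure (↑F ∪ Set.range L) := by
  classical
  have hCK : ∀ c ∈ C, c ∈ K := fun c hc => hFK ((hC c).1 hc).1
  let KC : Submodule C E :=
    { carrier := K
      add_mem' := fun ha hb => K.add_mem ha hb
      zero_mem' := K.zero_mem
      smul_mem' := fun c a ha => K.mul_mem (hCK c c.2) ha }
  have hKC : ∀ a, a ∈ KC ↔ a ∈ K := fun a => Iff.rfl
  obtain ⟨κ, a, hainj, hspan, hli⟩ := exists_linearIndependent' C (fun i => KC.mkQ (x i))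
  have : Finite κ := Finite.of_injective a hainj
  have : Fintype κ := Fintype.ofFinite κ
  let : LinearOrder κ := LinearOrder.lift' a hainj
  have hex : ∀ j, ∃ c : κ → C, x j - ∑ i, (c i : E) * x (a i) ∈ K := by
    intro j
    have h : KC.mkQ (x j) ∈ Submodule.span C (Set.range ((fun i => KC.mkQ (x i)) ∘ a)) := by
      rw [hspan]; exact Submodule.subset_span ⟨j, rfl⟩
    obtain ⟨c, hc⟩ := (Submodule.mem_span_range_iff_exists_fun C).1 h
    refine ⟨c, ?_⟩
    rw [← hKC, ← Submodule.ker_mkQ KC, LinearMap.mem_ker, map_sub, ← hc, map_sum, sub_eq_zero]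
    refine Finset.sum_congr rfl fun i _ => ?_
    exact ((KC.mkQ).map_smul (c i) (x (a i))).symm
  choose c hcK using hex
  let L : Fin n → E := fun j => x j - ∑ i, (c j i : E) * x (a i)
  have hLdef : ∀ j, x j = L j + ∑ i, (c j i : E) * x (a i) := fun j => by simp [L]
  refine ⟨n, L, ?_, ?_⟩
  · intro j
    refine ⟨fun l => (if l = j then 1 else 0) - ∑ i, if a i = l then (c j i : E) else 0, ?_, ?_⟩
    · intro l
      refine C.sub_mem ?_ (C.sum_mem fun i _ => ?_)
      · split_ifs
        · exact C.one_mem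
        · exact C.zero_mem
      · split_ifs
        · exact (c j i).2
        · exact C.zero_mem
    · simp only [sub_mul, Finset.sum_sub_distrib, Finset.sum_mul, L]
      rw [Finset.sum_comm]
      simp
  · apply le_antisymm
    swap
    · rw [Subfield.closure_le]
      rintro z (hz | ⟨j, rfl⟩)
      · exact hFK hz
      · exact hcK j
    · set F' := Subfield.closure (↑F ∪ Set.range L) with hF'
      have hFF' : F ≤ F' := fun z hz => Subfield.subset_closure (Or.inl hz)
      have hF'K : F' ≤ K := by
        rw [Subfield.closure_le]
        rintro z (hz | ⟨j, rfl⟩)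
        · exact hFK hz
        · exact hcK j
      -- algebraic independence over K
      let De : E →+ E := AddMonoidHom.mk' D hD.map_add
      have hDe : ∀ z, De z = D z := fun _ => rfl
      let d : K →+ K := AddMonoidHom.mk' (fun z => ⟨D z, hK z z.2⟩)
        (fun u v => Subtype.ext (hD.map_add u v))
      have hD1 : D 1 = 0 := by
        have := hD.leibniz 1 1
        simpa using this
      have hy : AlgebraicIndependent K (x ∘ a) := by
        refine ostrowski_algInd d De (Subtype.ext hD1) hD.leibniz (fun _ => rfl) ?_ (x ∘ a)
          (fun i => ⟨D (x (a i)), hFK (hx _)⟩) (fun _ => rfl) ?_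
        · intro z hz
          exact ⟨⟨z, hFK (hNNC z hz)⟩, rfl⟩
        · rintro e he ⟨b, hb⟩ i
          have heC : ∀ i, (e i : E) ∈ C := fun i => by
            have h0 : D (e i : E) = 0 := congrArg Subtype.val (he i)
            exact (hC _).2 ⟨hNNC _ h0, h0⟩
          have h := (Fintype.linearIndependent_iff.1 hli) (fun i => ⟨e i, heC i⟩) ?_ i
          · exact Subtype.ext (congrArg (fun u : C => (u : E)) h)
          · have h3 : KC.mkQ (∑ i, (⟨e i, heC i⟩ : C) • x (a i)) = 0 := by
              rw [← LinearMap.mem_ker, Submodule.ker_mkQ, hKC]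
              have : ∑ i, (⟨e i, heC i⟩ : C) • x (a i) = (b : E) := hb.symm
              rw [this]; exact b.2
            rw [map_sum] at h3
            rw [← h3]
            refine Finset.sum_congr rfl fun i _ => ?_
            exact ((KC.mkQ).map_smul _ (x (a i))).symm
      intro z hz
      have htop : z ∈ IntermediateField.adjoin F' (Set.range (x ∘ a)) := by
        have h : (⊤ : Subfield E) ≤
            (IntermediateField.adjoin F' (Set.range (x ∘ a))).toSubfield := by
          have hF'le : ∀ w ∈ F', w ∈ IntermediateField.adjoin F' (Set.range (x ∘ a)) :=
            fun w hw => IntermediateField.algebraMap_mem _ (⟨w, hw⟩ : F')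
          rw [← hgen, Subfield.closure_le]
          rintro w (hw | ⟨j, rfl⟩)
          · exact hF'le w (hFF' hw)
          · rw [hLdef j]
            refine add_mem (hF'le _ (Subfield.subset_closure (Or.inr ⟨j, rfl⟩)))
              (sum_mem fun i _ => mul_mem (hF'le _ (hFF' ((hC _).1 (c j i).2).1)) ?_)
            exact IntermediateField.subset_adjoin _ _ ⟨i, rfl⟩
        exact h trivial
      rw [IntermediateField.mem_adjoin_range_iff] at htop
      obtain ⟨r, s, hrs⟩ := htop
      by_cases hs : MvPolynomial.aeval (x ∘ a) s = 0
      · rw [hs, div_zero] at hrs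
        rw [hrs]; exact F'.zero_mem
      · have hmul : z * MvPolynomial.aeval (x ∘ a) s = MvPolynomial.aeval (x ∘ a) r := by
          rw [hrs, div_mul_cancel₀ _ hs]
        let φ : F' →+* K := Subfield.inclusion hF'K
        have hφ : ∀ p : MvPolynomial κ F', MvPolynomial.aeval (x ∘ a) (MvPolynomial.map φ p)
            = MvPolynomial.aeval (x ∘ a) p := by
          intro p
          rw [MvPolynomial.aeval_def, MvPolynomial.eval₂_map, MvPolynomial.aeval_def]
          rfl
        have hpoly : MvPolynomial.C (⟨z, hz⟩ : K) * MvPolynomial.map φ s = MvPolynomial.map φ r := by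
          apply hy
          rw [map_mul, hφ, hφ, MvPolynomial.aeval_C]
          exact hmul
        have hs0 : s ≠ 0 := by rintro rfl; simp at hs
        obtain ⟨m, hm⟩ := MvPolynomial.ne_zero_iff.1 hs0
        have hco := congrArg (fun p => ((MvPolynomial.coeff m p : K) : E)) hpoly
        simp only [MvPolynomial.coeff_C_mul, MvPolynomial.coeff_map] at hco
        have hco2 : z * (MvPolynomial.coeff m s : F') = (MvPolynomial.coeff m r : F') := hco
        have hm' : ((MvPolynomial.coeff m s : F') : E) ≠ 0 := fun h => hm (Subtype.ext h)
        rw [eq_div_of_mul_eq hm' hco2]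
        exact F'.div_mem (MvPolynomial.coeff m r).2 (MvPolynomial.coeff m s).2
end

section
/- Let F be a characteristic-zero differential field whose field of constants C is algebraically closed, and let E = F(x_1,…,x_n,e_1,…,e_m) be a no-new-constants differential field extension of F, where x_i′ ∈ F for all i, e_j ≠ 0 and e_j′/e_j ∈ F for all j, and the elements x_1,…,x_n,e_1,…,e_m are algebraically independent over F. Then for every u ∈ E there exist finitely many elements d_1,…,d_t of the F-linear span of {x_1,…,x_n} and finitely many power products p_1,…,p_s of the form Π_{i=1}^m e_i^{k_i} with k_i ∈ ℤ, such that F⟨u⟩ = F(d_1,…,d_t,p_1,…,p_s), where F⟨u⟩ denotes the differential subfield of E generated by F and u. -/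
namespace MixedExt

variable {E : Type*} [Field E]

lemma deriv_prod (D : Derivation ℤ E E) {J : Type*} [DecidableEq J] (s : Finset J) (f : J → E) :
    D (∏ j ∈ s, f j) = ∑ i ∈ s, D (f i) * ∏ j ∈ s.erase i, f j := by
  induction s using Finset.induction_on with
  | empty => simp
  | insert a s ha ih =>
    rw [Finset.prod_insert ha, Finset.sum_insert ha, D.leibniz, ih, Finset.erase_insert ha]
    simp only [smul_eq_mul]
    rw [Finset.mul_sum, add_comm, mul_comm]
    congr 1
    refine Finset.sum_congr rfl fun i hi => ?_
    have hia : i ≠ a := fun h => ha (h ▸ hi)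
    rw [Finset.erase_insert_of_ne hia.symm, Finset.prod_insert (fun h => ha (Finset.mem_of_mem_erase h))]
    ring

/-- monomial -/
def mon {J : Type*} [Fintype J] (y : J → E) (α : J →₀ ℕ) : E := ∏ j, y j ^ α j

lemma deriv_mon (D : Derivation ℤ E E) {J : Type*} [Fintype J] [DecidableEq J] (y : J → E)
    (α : J →₀ ℕ) :
    D (mon y α) = ∑ i, (α i : E) * D (y i) * mon y (α - Finsupp.single i 1) := by
  unfold mon
  rw [deriv_prod]
  refine Finset.sum_congr rfl fun i _ => ?_
  rw [← Finset.mul_prod_erase Finset.univ (fun j => y j ^ ((α - Finsupp.single i 1 : J →₀ ℕ) j))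
    (Finset.mem_univ i), D.leibniz_pow]
  have : ∏ j ∈ Finset.univ.erase i, y j ^ ((α - Finsupp.single i 1 : J →₀ ℕ) j)
      = ∏ j ∈ Finset.univ.erase i, y j ^ α j := by
    refine Finset.prod_congr rfl fun j hj => ?_
    have : i ≠ j := (Finset.ne_of_mem_erase hj).symm
    simp [Finsupp.single_apply, this]
  rw [this]
  simp
  ring

/-- evaluation of a formal combination -/
noncomputable def ev {J Q : Type*} [Fintype J] (y : J → E) (w : Q → E) :
    (Q × (J →₀ ℕ) →₀ E) →ₗ[E] E :=
  Finsupp.linearCombination E (fun i => w i.1 * mon y i.2)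

/-- the formal derivative, twisted by `η`. -/
noncomputable def G (D : Derivation ℤ E E) {J Q : Type*} [Fintype J] (y : J → E) (η : Q → E) :
    (Q × (J →₀ ℕ) →₀ E) →+ (Q × (J →₀ ℕ) →₀ E) :=
  Finsupp.liftAddHom (fun i =>
    { toFun := fun c => Finsupp.single i (D c + η i.1 * c) +
        ∑ j, Finsupp.single (i.1, i.2 - Finsupp.single j 1) ((i.2 j : E) * D (y j) * c)
      map_zero' := by simp
      map_add' := fun a b => by
        simp only [map_add, mul_add, Finsupp.single_add, Finset.sum_add_distrib]
        abel })

lemma G_single (D : Derivation ℤ E E) {J Q : Type*} [Fintype J] (y : J → E) (η : Q → E)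
    (i : Q × (J →₀ ℕ)) (c : E) : G D y η (Finsupp.single i c) = Finsupp.single i (D c + η i.1 * c) +
        ∑ j, Finsupp.single (i.1, i.2 - Finsupp.single j 1) ((i.2 j : E) * D (y j) * c) := by
  simp [G]

lemma ev_G (D : Derivation ℤ E E) {J Q : Type*} [Fintype J] [DecidableEq J] (y : J → E)
    (w : Q → E) (hw0 : ∀ q, w q ≠ 0) (η0 : E) (f : Q × (J →₀ ℕ) →₀ E) :
    ev y w (G D y (fun q => D (w q) / w q - η0) f) = D (ev y w f) - η0 * ev y w f := by
  induction f using Finsupp.induction_linear with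
  | zero => simp
  | add f g hf hg => simp only [map_add, hf, hg]; ring
  | single i c =>
    rw [G_single]
    simp only [ev, map_add, map_sum, Finsupp.linearCombination_single, smul_eq_mul, D.leibniz,
      deriv_mon]
    have := hw0 i.1
    simp only [mul_add, Finset.mul_sum]
    field_simp
    ring

lemma G_apply (D : Derivation ℤ E E) {J Q : Type*} [Fintype J] [DecidableEq J] (y : J → E)
    (η : Q → E) (f : Q × (J →₀ ℕ) →₀ E) (q : Q) (β : J →₀ ℕ) :
    G D y η f (q, β) = D (f (q, β)) + η q * f (q, β) +
      ∑ j, ((β j : E) + 1) * D (y j) * f (q, β + Finsupp.single j 1) := by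
  classical
  induction f using Finsupp.induction_linear with
  | zero => simp
  | add f g hf hg =>
    simp only [map_add, Finsupp.add_apply, hf, hg, mul_add, Finset.sum_add_distrib]; ring
  | single i c =>
    obtain ⟨q', α⟩ := i
    rw [G_single]
    simp only [Finsupp.add_apply, Finsupp.finsetSum_apply]
    congr 1
    · simp only [Finsupp.single_apply]
      split_ifs with h
      · simp_all
      · simp
    · refine Finset.sum_congr rfl fun j _ => ?_
      simp only [Finsupp.single_apply, Prod.mk.injEq]
      by_cases h : q' = q ∧ α = β + Finsupp.single j 1
      · obtain ⟨rfl, rfl⟩ := h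
        simp
      · rw [if_neg h, mul_zero]
        split_ifs with h2
        · by_cases h0 : α j = 0
          · simp [h0]
          · exfalso
            apply h
            refine ⟨h2.1, ?_⟩
            rw [← h2.2, tsub_add_cancel_of_le]
            simpa using Nat.one_le_iff_ne_zero.2 h0
        · rfl

lemma step [CharZero E] (D : Derivation ℤ E E) (K : Subfield E)
    (hN : ∀ a, D a = 0 → a ∈ K) {J Q : Type*} [Fintype J] [DecidableEq J]
    (y : J → E) (w : Q → E) (hw0 : ∀ q, w q ≠ 0)
    (hQ : ∀ q q', w q / w q' ∈ K → q = q')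
    (hind : ∀ c : J → E, (∀ j, D (c j) = 0) → ∑ j, c j * y j ∈ K → ∀ j, c j = 0)
    (d : ℕ) (f : Q × (J →₀ ℕ) →₀ E) (hf : ∀ i, f i ∈ K) (hev : ev y w f = 0)
    (hd : ∀ i, f i ≠ 0 → i.2.degree ≤ d) (q0 : Q) (α0 : J →₀ ℕ) (h1 : f (q0, α0) = 1)
    (hdeg : α0.degree = d)
    (hG : G D y (fun q => D (w q) / w q - D (w q0) / w q0) f = 0) : False := by
  have hG' : ∀ q β, D (f (q, β)) + (D (w q) / w q - D (w q0) / w q0) * f (q, β) +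
      ∑ j, ((β j : E) + 1) * D (y j) * f (q, β + Finsupp.single j 1) = 0 := by
    intro q β
    rw [← G_apply D y (fun q => D (w q) / w q - D (w q0) / w q0) f q β, hG]
    rfl
  have hbig : ∀ q (β : J →₀ ℕ), d < β.degree → f (q, β) = 0 := by
    intro q β h
    by_contra h'
    exact absurd (hd _ h') (not_le.2 h)
  have htop : ∀ q (β : J →₀ ℕ), β.degree = d →
      D (f (q, β)) + (D (w q) / w q - D (w q0) / w q0) * f (q, β) = 0 := by
    intro q β h
    have := hG' q β
    rw [Finset.sum_eq_zero, add_zero] at this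
    · exact this
    · intro j _
      rw [hbig, mul_zero]
      simp [h]
  rcases Nat.eq_zero_or_pos d with rfl | hpos
  · have hα0 : α0 = 0 := (Finsupp.degree_eq_zero_iff _).1 hdeg
    subst hα0
    have hall : ∀ i, i ≠ (q0, (0 : J →₀ ℕ)) → f i = 0 := by
      rintro ⟨q, β⟩ hne
      by_contra hne0
      have hβ : β = 0 := (Finsupp.degree_eq_zero_iff _).1 (Nat.le_zero.1 (hd _ hne0))
      subst hβ
      have h := htop q 0 (by simp)
      have hc : D (f (q, 0) * (w q / w q0)) = 0 := by
        rw [D.leibniz, D.leibniz_div]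
        simp only [smul_eq_mul]
        have e1 := hw0 q
        have e2 := hw0 q0
        have h3 : D (f (q, 0)) = - ((D (w q) / w q - D (w q0) / w q0) * f (q, 0)) :=
          eq_neg_of_add_eq_zero_left h
        rw [h3]
        field_simp
        ring
      have h4 := hN _ hc
      have h5 : w q / w q0 ∈ K := by
        have := K.div_mem h4 (hf (q, 0))
        rwa [mul_div_cancel_left₀ _ hne0] at this
      exact hne (by rw [hQ _ _ h5])
    classical
    have hfs : f = Finsupp.single (q0, 0) 1 := by
      ext i
      by_cases hi : i = (q0, 0)
      · subst hi; simp [h1]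
      · rw [hall i hi, Finsupp.single_apply, if_neg (Ne.symm hi)]
    rw [hfs] at hev
    simp [ev, mon, hw0] at hev
  · have : ∃ i1, α0 i1 ≠ 0 := by
      by_contra hcon
      push Not at hcon
      have : α0 = 0 := by ext; simp [hcon]
      subst this
      simp at hdeg
      omega
    obtain ⟨i1, hi1⟩ := this
    set β := α0 - Finsupp.single i1 1 with hβ
    have hβα : β + Finsupp.single i1 1 = α0 := by
      rw [hβ, tsub_add_cancel_of_le]
      simpa using Nat.one_le_iff_ne_zero.2 hi1
    have hβd : β.degree + 1 = d := by
      rw [← hdeg, ← hβα]; simp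
    have hcst : ∀ j, D (f (q0, β + Finsupp.single j 1)) = 0 := by
      intro j
      have := htop q0 (β + Finsupp.single j 1) (by simp [hβd])
      simpa using this
    have hc2 : ∀ j, D (((β j : E) + 1) * f (q0, β + Finsupp.single j 1)) = 0 := by
      intro j
      rw [D.leibniz, hcst]
      simp
    have h := hG' q0 β
    have hz : D (f (q0, β) + ∑ j, (((β j : E) + 1) * f (q0, β + Finsupp.single j 1)) * y j) = 0 := by
      rw [← h, map_add, map_sum, sub_self, zero_mul, add_zero]
      congr 1
      refine Finset.sum_congr rfl fun j _ => ?_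
      rw [D.leibniz, hc2]
      simp only [smul_eq_mul]
      ring
    have hmem := K.sub_mem (hN _ hz) (hf (q0, β))
    rw [add_sub_cancel_left] at hmem
    have h6 := hind _ hc2 hmem i1
    rw [hβα, h1, mul_one] at h6
    exact Nat.cast_add_one_ne_zero _ h6

lemma step2 [CharZero E] (D : Derivation ℤ E E) (K : Subfield E) (hK : ∀ a ∈ K, D a ∈ K)
    (hN : ∀ a, D a = 0 → a ∈ K) {J Q : Type*} [Fintype J] [DecidableEq J]
    (y : J → E) (hy : ∀ j, D (y j) ∈ K) (w : Q → E) (hw0 : ∀ q, w q ≠ 0)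
    (hw : ∀ q, D (w q) / w q ∈ K) (hQ : ∀ q q', w q / w q' ∈ K → q = q')
    (hind : ∀ c : J → E, (∀ j, D (c j) = 0) → ∑ j, c j * y j ∈ K → ∀ j, c j = 0)
    (d t : ℕ)
    (IH : ∀ (f : Q × (J →₀ ℕ) →₀ E), (∀ i, f i ∈ K) → ev y w f = 0 →
      (∀ i, f i ≠ 0 → i.2.degree ≤ d) → (f.support.filter (fun i => i.2.degree = d)).card ≤ t →
      f = 0)
    (f : Q × (J →₀ ℕ) →₀ E) (hf : ∀ i, f i ∈ K) (hev : ev y w f = 0)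
    (hd : ∀ i, f i ≠ 0 → i.2.degree ≤ d)
    (ht : (f.support.filter (fun i => i.2.degree = d)).card ≤ t + 1) : f = 0 := by
  by_cases hemp : (f.support.filter (fun i => i.2.degree = d)) = ∅
  · exact IH f hf hev hd (by simp [hemp])
  obtain ⟨⟨q0, α0⟩, hi0⟩ := Finset.nonempty_iff_ne_empty.2 hemp
  have hi0' := hi0
  rw [Finset.mem_filter, Finsupp.mem_support_iff] at hi0
  obtain ⟨hne, hdeg⟩ := hi0
  exfalso
  set f' := (f (q0, α0))⁻¹ • f with hf'
  have hf'K : ∀ i, f' i ∈ K := fun i => K.mul_mem (K.inv_mem (hf _)) (hf i)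
  have hf'ev : ev y w f' = 0 := by rw [hf', map_smul, hev, smul_zero]
  have hf'0 : ∀ i, f i = 0 → f' i = 0 := fun i hi => by simp [hf', hi]
  have hf'd : ∀ i, f' i ≠ 0 → i.2.degree ≤ d := fun i hi => hd i (fun h => hi (hf'0 i h))
  have h1 : f' (q0, α0) = 1 := by simp [hf', hne]
  refine step D K hN y w hw0 hQ hind d f' hf'K hf'ev hf'd q0 α0 h1 hdeg ?_
  set η : Q → E := fun q => D (w q) / w q - D (w q0) / w q0 with hη
  have hbig : ∀ q (β : J →₀ ℕ), d ≤ β.degree →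
      G D y η f' (q, β) = D (f' (q, β)) + η q * f' (q, β) := by
    intro q β h
    rw [G_apply, Finset.sum_eq_zero, add_zero]
    intro j _
    by_cases h0 : f' (q, β + Finsupp.single j 1) = 0
    · rw [h0, mul_zero]
    · have := hf'd _ h0
      simp at this
      omega
  have hzero : ∀ q (β : J →₀ ℕ), d ≤ β.degree → f (q, β) = 0 → G D y η f' (q, β) = 0 := by
    intro q β h h0
    rw [hbig q β h, hf'0 _ h0]
    simp
  apply IH
  · rintro ⟨q, β⟩
    rw [G_apply]
    refine K.add_mem (K.add_mem (hK _ (hf'K _)) (K.mul_mem (K.sub_mem (hw _) (hw _)) (hf'K _))) ?_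
    refine K.sum_mem fun j _ => K.mul_mem (K.mul_mem (K.add_mem (natCast_mem K _) K.one_mem) (hy j)) (hf'K _)
  · rw [ev_G D y w hw0, hf'ev]; simp
  · rintro ⟨q, β⟩ h
    by_contra hlt
    push Not at hlt
    apply h
    apply hzero q β hlt.le
    by_contra h0
    exact absurd (hd _ h0) (not_le.2 hlt)
  · have hss : (Finset.filter (fun i : Q × (J →₀ ℕ) => i.2.degree = d) (G D y η f').support) ⊂
        (f.support.filter (fun i => i.2.degree = d)) := by
      rw [Finset.ssubset_iff_of_subset]
      · refine ⟨(q0, α0), hi0', ?_⟩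
        rw [Finset.mem_filter, Finsupp.mem_support_iff, hbig q0 α0 hdeg.ge, h1]
        simp [hη]
      · rintro ⟨q, β⟩ h
        rw [Finset.mem_filter, Finsupp.mem_support_iff] at h ⊢
        exact ⟨fun h0 => h.1 (hzero q β h.2.ge h0), h.2⟩
    have := Finset.card_lt_card hss
    omega

theorem key [CharZero E] (D : Derivation ℤ E E) (K : Subfield E) (hK : ∀ a ∈ K, D a ∈ K)
    (hN : ∀ a, D a = 0 → a ∈ K) {J Q : Type*} [Fintype J] [DecidableEq J]
    (y : J → E) (hy : ∀ j, D (y j) ∈ K) (w : Q → E) (hw0 : ∀ q, w q ≠ 0)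
    (hw : ∀ q, D (w q) / w q ∈ K) (hQ : ∀ q q', w q / w q' ∈ K → q = q')
    (hind : ∀ c : J → E, (∀ j, D (c j) = 0) → ∑ j, c j * y j ∈ K → ∀ j, c j = 0)
    (d : ℕ) : ∀ (t : ℕ) (f : Q × (J →₀ ℕ) →₀ E), (∀ i, f i ∈ K) → ev y w f = 0 →
      (∀ i, f i ≠ 0 → i.2.degree ≤ d) → (f.support.filter (fun i => i.2.degree = d)).card ≤ t →
      f = 0 := by
  have hlow : ∀ (d : ℕ) (f : Q × (J →₀ ℕ) →₀ E), (∀ i, f i ≠ 0 → i.2.degree ≤ d) →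
      (f.support.filter (fun i => i.2.degree = d)).card ≤ 0 → ∀ i, f i ≠ 0 → i.2.degree < d := by
    intro d f h1 h2 i hi
    refine lt_of_le_of_ne (h1 i hi) fun h => ?_
    rw [Nat.le_zero, Finset.card_eq_zero] at h2
    have : i ∈ f.support.filter (fun i => i.2.degree = d) := by simp [hi, h]
    simp [h2] at this
  induction d with
  | zero =>
    intro t
    induction t with
    | zero =>
      intro f hf hev hd ht
      ext i
      by_contra hi
      exact absurd (hlow 0 f hd ht i hi) (Nat.not_lt_zero _)
    | succ t iht => exact step2 D K hK hN y hy w hw0 hw hQ hind 0 t iht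
  | succ d ihd =>
    intro t
    induction t with
    | zero =>
      intro f hf hev hd ht
      exact ihd _ f hf hev (fun i hi => Nat.lt_succ_iff.1 (hlow _ f hd ht i hi)) le_rfl
    | succ t iht => exact step2 D K hK hN y hy w hw0 hw hQ hind _ t iht

theorem key' [CharZero E] (D : Derivation ℤ E E) (K : Subfield E) (hK : ∀ a ∈ K, D a ∈ K)
    (hN : ∀ a, D a = 0 → a ∈ K) {J Q : Type*} [Fintype J] [DecidableEq J]
    (y : J → E) (hy : ∀ j, D (y j) ∈ K) (w : Q → E) (hw0 : ∀ q, w q ≠ 0)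
    (hw : ∀ q, D (w q) / w q ∈ K) (hQ : ∀ q q', w q / w q' ∈ K → q = q')
    (hind : ∀ c : J → E, (∀ j, D (c j) = 0) → ∑ j, c j * y j ∈ K → ∀ j, c j = 0)
    (f : Q × (J →₀ ℕ) →₀ E) (hf : ∀ i, f i ∈ K) (hev : ev y w f = 0) : f = 0 := by
  refine key D K hK hN y hy w hw0 hw hQ hind (f.support.sup fun i => i.2.degree) _ f hf hev ?_ le_rfl
  intro i hi
  exact Finset.le_sup (f := fun i : Q × (J →₀ ℕ) => i.2.degree) (Finsupp.mem_support_iff.2 hi)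


lemma logD_mem (D : Derivation ℤ E E) (F : Subfield E) {m : ℕ} (e : Fin m → E)
    (he0 : ∀ j, e j ≠ 0) (he : ∀ j, D (e j) / e j ∈ F) (k : Fin m → ℤ) :
    D (∏ i, e i ^ k i) / (∏ i, e i ^ k i) ∈ F := by
  rw [deriv_prod, Finset.sum_div]
  refine F.sum_mem fun i _ => ?_
  rw [← Finset.mul_prod_erase Finset.univ (fun j => e j ^ k j) (Finset.mem_univ i)]
  have h0 : ∏ j ∈ Finset.univ.erase i, e j ^ k j ≠ 0 :=
    Finset.prod_ne_zero_iff.2 fun j _ => zpow_ne_zero _ (he0 j)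
  rw [mul_div_mul_right _ _ h0, D.leibniz_zpow]
  have : k i • e i ^ (k i - 1) • D (e i) / e i ^ k i = (k i : E) * (D (e i) / e i) := by
    rw [zpow_sub_one₀ (he0 i), zsmul_eq_mul, smul_eq_mul]
    have := zpow_ne_zero (k i) (he0 i)
    have := he0 i
    field_simp
  rw [this]
  exact F.mul_mem (intCast_mem F _) (he i)

/-- power products -/
def pp {m : ℕ} (e : Fin m → E) (k : Fin m → ℤ) : E := ∏ i, e i ^ k i

lemma pp_ne {m : ℕ} (e : Fin m → E) (he0 : ∀ j, e j ≠ 0) (k : Fin m → ℤ) : pp e k ≠ 0 :=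
  Finset.prod_ne_zero_iff.2 fun j _ => zpow_ne_zero _ (he0 j)

lemma pp_add {m : ℕ} (e : Fin m → E) (he0 : ∀ j, e j ≠ 0) (k l : Fin m → ℤ) :
    pp e (k + l) = pp e k * pp e l := by
  simp [pp, zpow_add₀ (he0 _), Finset.prod_mul_distrib]

lemma pp_neg {m : ℕ} (e : Fin m → E) (k : Fin m → ℤ) :
    pp e (-k) = (pp e k)⁻¹ := by
  simp [pp]

lemma pp_zero {m : ℕ} (e : Fin m → E) : pp e 0 = 1 := by simp [pp]

lemma pp_single {m : ℕ} (e : Fin m → E) (j : Fin m) : pp e (Pi.single j 1) = e j := by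
  unfold pp
  rw [Finset.prod_eq_single j]
  · simp
  · intro b _ hb; simp [hb]
  · simp

lemma mon_add {J : Type*} [Fintype J] (y : J → E) (α β : J →₀ ℕ) :
    mon y (α + β) = mon y α * mon y β := by
  simp [mon, pow_add, Finset.prod_mul_distrib]

lemma mon_single {J : Type*} [Fintype J] [DecidableEq J] (y : J → E) (j : J) :
    mon y (Finsupp.single j 1) = y j := by
  unfold mon
  rw [Finset.prod_eq_single j]
  · simp
  · intro b _ hb; simp [Finsupp.single_apply, hb.symm]
  · simp

/-- exponents of the power products lying in `K`. -/
def expGroup {m : ℕ} (e : Fin m → E) (he0 : ∀ j, e j ≠ 0) (K : Subfield E) :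
    AddSubgroup (Fin m → ℤ) where
  carrier := {k | pp e k ∈ K}
  zero_mem' := by
    change pp e 0 ∈ K
    rw [pp_zero]; exact K.one_mem
  add_mem' := fun {a b} ha hb => by
    change pp e (a + b) ∈ K
    rw [pp_add e he0]; exact K.mul_mem ha hb
  neg_mem' := fun {a} ha => by
    change pp e (-a) ∈ K
    rw [pp_neg]; exact K.inv_mem ha

theorem main [CharZero E] (D : Derivation ℤ E E)
    (F : Subfield E) (hF : ∀ a ∈ F, D a ∈ F)
    (C : Subfield E) (hC : ∀ c : E, c ∈ C ↔ (c ∈ F ∧ D c = 0))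
    (hNNC : ∀ a : E, D a = 0 → a ∈ F)
    {n m : ℕ} (x : Fin n → E) (hx : ∀ i, D (x i) ∈ F)
    (e : Fin m → E) (he0 : ∀ j, e j ≠ 0) (he : ∀ j, D (e j) / e j ∈ F)
    (hgen : Subfield.closure (↑F ∪ (Set.range x ∪ Set.range e)) = ⊤)
    (K : Subfield E) (hFK : F ≤ K) (hKD : ∀ a ∈ K, D a ∈ K) :
    ∃ (t s : ℕ) (d : Fin t → E) (p : Fin s → E),
      (∀ i, ∃ f : Fin n → E, (∀ j, f j ∈ F) ∧ d i = ∑ j, f j * x j) ∧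
      (∀ j, ∃ k : Fin m → ℤ, p j = ∏ i, e i ^ k i) ∧
      K = Subfield.closure (↑F ∪ (Set.range d ∪ Set.range p)) := by
  classical
  have hCF : ∀ c : C, (c : E) ∈ F := fun c => ((hC _).1 c.2).1
  -- the subfield `K` as a `C`-subspace
  let KC : Submodule C E :=
    { carrier := K
      zero_mem' := K.zero_mem
      add_mem' := fun ha hb => K.add_mem ha hb
      smul_mem' := fun c a ha => K.mul_mem (hFK (hCF c)) ha }
  have hKC : ∀ a, a ∈ KC ↔ a ∈ K := fun a => Iff.rfl
  obtain ⟨J, a, ha, hspan, hli⟩ := exists_linearIndependent' C (KC.mkQ ∘ x)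
  have : Finite J := Finite.of_injective a ha
  have : Fintype J := Fintype.ofFinite J
  set y : J → E := x ∘ a with hy
  have hdex : ∀ i, ∃ c : J → C, x i - ∑ j, (c j : E) * y j ∈ K := by
    intro i
    have : (KC.mkQ ∘ x) i ∈ Submodule.span C (Set.range ((KC.mkQ ∘ x) ∘ a)) := by
      rw [hspan]; exact Submodule.subset_span ⟨i, rfl⟩
    rw [Submodule.mem_span_range_iff_exists_fun] at this
    obtain ⟨c, hc⟩ := this
    refine ⟨c, ?_⟩
    rw [← hKC, ← Submodule.ker_mkQ KC, LinearMap.mem_ker, map_sub, sub_eq_zero]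
    change (KC.mkQ ∘ x) i = _
    rw [← hc, map_sum]
    refine Finset.sum_congr rfl fun j _ => ?_
    change c j • KC.mkQ (x (a j)) = KC.mkQ (c j • x (a j))
    rw [map_smul]
  choose c hcK using hdex
  have hind : ∀ c : J → E, (∀ j, D (c j) = 0) → ∑ j, c j * y j ∈ K → ∀ j, c j = 0 := by
    intro c hc hsum
    have hcC : ∀ j, c j ∈ C := fun j => (hC _).2 ⟨hNNC _ (hc j), hc j⟩
    rw [Fintype.linearIndependent_iff] at hli
    have := hli (fun j => ⟨c j, hcC j⟩) (by
      rw [← hKC, ← Submodule.ker_mkQ KC, LinearMap.mem_ker, map_sum] at hsum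
      rw [← hsum]
      refine Finset.sum_congr rfl fun j _ => ?_
      change (⟨c j, hcC j⟩ : C) • KC.mkQ (x (a j)) = KC.mkQ ((⟨c j, hcC j⟩ : C) • x (a j))
      rw [map_smul])
    intro j
    exact congrArg Subtype.val (this j)
  -- power products
  set P := expGroup e he0 K with hP
  have hPmem : ∀ k, k ∈ P ↔ pp e k ∈ K := fun k => Iff.rfl
  have hfg : (AddSubgroup.toIntSubmodule P).FG := IsNoetherian.noetherian _
  obtain ⟨s, g, hg⟩ := Submodule.fg_iff_exists_fin_generating_family.1 hfg
  have hgP : ∀ i, g i ∈ P := by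
    intro i
    have : g i ∈ AddSubgroup.toIntSubmodule P := by
      rw [← hg]; exact Submodule.subset_span ⟨i, rfl⟩
    exact this
  refine ⟨n, s, fun i => x i - ∑ j, (c i j : E) * y j, fun i => pp e (g i), ?_, fun i => ⟨g i, rfl⟩, ?_⟩
  · intro i
    refine ⟨fun l => (if l = i then 1 else 0) - ∑ j, if a j = l then (c i j : E) else 0, ?_, ?_⟩
    · intro l
      refine F.sub_mem ?_ (F.sum_mem fun j _ => ?_)
      · split_ifs
        exacts [F.one_mem, F.zero_mem]
      · split_ifs
        exacts [hCF _, F.zero_mem]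
    · simp only [sub_mul, Finset.sum_sub_distrib, Finset.sum_mul, ite_mul, one_mul, zero_mul]
      rw [Finset.sum_comm]
      simp [hy]
  set K0 := Subfield.closure ((F : Set E) ∪ (Set.range (fun i => x i - ∑ j, (c i j : E) * y j) ∪
    Set.range (fun i => pp e (g i)))) with hK0
  have hFK0 : F ≤ K0 := fun z hz => Subfield.subset_closure (Or.inl hz)
  have hdK0 : ∀ i, x i - ∑ j, (c i j : E) * y j ∈ K0 := fun i =>
    Subfield.subset_closure (Or.inr (Or.inl ⟨i, rfl⟩))
  have hPK0 : ∀ k ∈ P, pp e k ∈ K0 := by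
    intro k hk
    have hle : AddSubgroup.toIntSubmodule P ≤ AddSubgroup.toIntSubmodule (expGroup e he0 K0) := by
      rw [← hg, Submodule.span_le]
      rintro _ ⟨i, rfl⟩
      exact Subfield.subset_closure (Or.inr (Or.inr ⟨i, rfl⟩))
    exact hle hk
  have hK0K : K0 ≤ K := by
    rw [hK0, Subfield.closure_le]
    rintro z (hz | ⟨i, rfl⟩ | ⟨i, rfl⟩)
    · exact hFK hz
    · exact hcK i
    · exact hgP i
  refine le_antisymm ?_ hK0K
  -- the family of monomials
  let w : (Fin m → ℤ) ⧸ P → E := fun q => pp e q.out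
  have hw0 : ∀ q, w q ≠ 0 := fun q => pp_ne e he0 _
  have hQ : ∀ q q', w q / w q' ∈ K → q = q' := by
    intro q q' h
    have : -q'.out + q.out ∈ P := by
      rw [hPmem, pp_add e he0, pp_neg, mul_comm, ← div_eq_mul_inv]
      exact h
    rw [← QuotientAddGroup.eq] at this
    simpa using this.symm
  have hkey := key' D K hKD (fun z hz => hFK (hNNC z hz)) y (fun j => hFK (hx _)) w hw0
    (fun q => hFK (logD_mem D F e he0 he _)) hQ hind
  -- spanning
  let v : ((Fin m → ℤ) ⧸ P) × (J →₀ ℕ) → E := fun i => w i.1 * mon y i.2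
  have hmon : ∀ k α, pp e k * mon y α ∈ Submodule.span K0 (Set.range v) := by
    intro k α
    have h1 : -(QuotientAddGroup.mk k : (Fin m → ℤ) ⧸ P).out + k ∈ P := by
      rw [← QuotientAddGroup.eq]; simp
    have h2 : pp e k * mon y α = (⟨_, hPK0 _ h1⟩ : K0) • v (QuotientAddGroup.mk k, α) := by
      change _ = pp e _ * (pp e _ * mon y α)
      rw [pp_add e he0, pp_neg]
      have := pp_ne e he0 (QuotientAddGroup.mk k : (Fin m → ℤ) ⧸ P).out
      field_simp
    rw [h2]
    exact Submodule.smul_mem _ _ (Submodule.subset_span ⟨_, rfl⟩)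
  have hsub : ∀ z ∈ Subring.closure ((F : Set E) ∪ (Set.range x ∪ Set.range e)),
      z ∈ Submodule.span K0 (Set.range v) := by
    have hA : ∀ z ∈ Subring.closure ((F : Set E) ∪ (Set.range x ∪ Set.range e)),
        z ∈ Algebra.adjoin K0 (Set.range y ∪ Set.range e) := by
      intro z hz
      have hle : Subring.closure ((F : Set E) ∪ (Set.range x ∪ Set.range e)) ≤
          (Algebra.adjoin K0 (Set.range y ∪ Set.range e)).toSubring := by
        rw [Subring.closure_le]
        have hal : ∀ z ∈ K0, z ∈ Algebra.adjoin K0 (Set.range y ∪ Set.range e) :=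
          fun z hz => (Algebra.adjoin K0 (Set.range y ∪ Set.range e)).algebraMap_mem ⟨z, hz⟩
        rintro z (hz | ⟨i, rfl⟩ | ⟨i, rfl⟩)
        · exact hal z (hFK0 hz)
        · have h1 : x i = (x i - ∑ j, (c i j : E) * y j) + ∑ j, (c i j : E) * y j := by ring
          change x i ∈ Algebra.adjoin K0 (Set.range y ∪ Set.range e)
          rw [h1]
          refine add_mem (hal _ (hdK0 i)) (sum_mem fun j _ => mul_mem (hal _ (hFK0 (hCF _))) ?_)
          exact Algebra.subset_adjoin (Or.inl ⟨j, rfl⟩)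
        · exact Algebra.subset_adjoin (Or.inr ⟨i, rfl⟩)
      exact hle hz
    intro z hz
    have h1 := hA z hz
    rw [← Subalgebra.mem_toSubmodule, Algebra.adjoin_eq_span] at h1
    refine Submodule.span_le.2 ?_ h1
    intro z hz
    have h2 : ∃ k α, z = pp e k * mon y α := by
      refine Submonoid.closure_induction (motive := fun z _ => ∃ k α, z = pp e k * mon y α)
        ?_ ?_ ?_ hz
      · rintro _ (⟨j, rfl⟩ | ⟨j, rfl⟩)
        · exact ⟨0, Finsupp.single j 1, by rw [pp_zero, mon_single, one_mul]⟩
        · exact ⟨Pi.single j 1, 0, by rw [pp_single]; simp [mon]⟩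
      · exact ⟨0, 0, by simp [pp, mon]⟩
      · rintro _ _ _ _ ⟨k, α, rfl⟩ ⟨l, β, rfl⟩
        exact ⟨k + l, α + β, by rw [pp_add e he0, mon_add]; ring⟩
    obtain ⟨k, α, rfl⟩ := h2
    exact hmon k α
  have hrep : ∀ z ∈ Subring.closure ((F : Set E) ∪ (Set.range x ∪ Set.range e)),
      ∃ f : ((Fin m → ℤ) ⧸ P) × (J →₀ ℕ) →₀ E, (∀ i, f i ∈ K0) ∧ ev y w f = z := by
    intro z hz
    have := hsub z hz
    rw [Finsupp.mem_span_range_iff_exists_finsupp] at this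
    obtain ⟨f, hf⟩ := this
    refine ⟨f.mapRange Subtype.val rfl, fun i => by simp, ?_⟩
    rw [← hf, ev, Finsupp.linearCombination_apply, Finsupp.sum_mapRange_index (by simp)]
    rfl
  intro u hu
  have huE : u ∈ Subfield.closure ((F : Set E) ∪ (Set.range x ∪ Set.range e)) := by
    rw [hgen]; trivial
  rw [Subfield.mem_closure_iff] at huE
  obtain ⟨z1, hz1, z2, hz2, rfl⟩ := huE
  by_cases h0 : z2 = 0
  · rw [h0, div_zero]; exact K0.zero_mem
  obtain ⟨f1, hf1, hf1'⟩ := hrep z1 hz1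
  obtain ⟨f2, hf2, hf2'⟩ := hrep z2 hz2
  have hz := hkey (f1 - (z1 / z2) • f2)
    (fun i => K.sub_mem (hK0K (hf1 i)) (K.mul_mem hu (hK0K (hf2 i))))
    (by rw [map_sub, map_smul, hf1', hf2', smul_eq_mul, div_mul_cancel₀ _ h0, sub_self])
  have hne : f2 ≠ 0 := by
    rintro rfl
    exact h0 (by rw [← hf2', map_zero])
  obtain ⟨i, hi⟩ := Finsupp.ne_iff.1 hne
  have hi' : f2 i ≠ 0 := hi
  have h3 : f1 i = z1 / z2 * f2 i := by
    have := DFunLike.congr_fun hz i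
    simpa [sub_eq_zero] using this
  have h4 : z1 / z2 = f1 i / f2 i := by rw [h3, mul_div_cancel_right₀ _ hi']
  rw [h4]
  exact K0.div_mem (hf1 i) (hf2 i)

end MixedExt

/-- Let `E = F(x₁,…,xₙ,e₁,…,eₘ)` be a no-new-constants differential field extension
of a characteristic-zero differential field `F` with algebraically closed field of
constants `C`, where `xᵢ' ∈ F`, the `eⱼ` are nonzero with `eⱼ'/eⱼ ∈ F`, and the
`xᵢ, eⱼ` are jointly algebraically independent over `F`.  Then for every `u ∈ E`
there are finitely many `F`-linear combinations `d₁, …, d_t` of the `xᵢ` and finitely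
many power products `p₁, …, p_s` of the `eⱼ` such that
`F⟨u⟩ = F(d₁, …, d_t, p₁, …, p_s)`. -/
theorem mixed_extension_singly_generated_structure
    {E : Type*} [Field E] [CharZero E]
    (D : E → E) (hD : IsDerivation D)
    (F : Subfield E) (hF : ∀ a ∈ F, D a ∈ F)
    (C : Subfield E) (hC : ∀ c : E, c ∈ C ↔ (c ∈ F ∧ D c = 0))
    [IsAlgClosed C]
    (hNNC : ∀ a : E, D a = 0 → a ∈ F)
    {n m : ℕ} (x : Fin n → E) (hx : ∀ i, D (x i) ∈ F)
    (e : Fin m → E) (he0 : ∀ j, e j ≠ 0) (he : ∀ j, D (e j) / e j ∈ F)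
    (hind : AlgebraicIndependent F (Sum.elim x e))
    (hgen : Subfield.closure (↑F ∪ (Set.range x ∪ Set.range e)) = ⊤)
    (u : E) :
    ∃ (t s : ℕ) (d : Fin t → E) (p : Fin s → E),
      (∀ i, ∃ f : Fin n → E, (∀ j, f j ∈ F) ∧ d i = ∑ j, f j * x j) ∧
      (∀ j, ∃ k : Fin m → ℤ, p j = ∏ i, e i ^ k i) ∧
      diffSubfieldClosure D (↑F ∪ {u}) =
        Subfield.closure (↑F ∪ (Set.range d ∪ Set.range p)) := by
  classical
  let D' : Derivation ℤ E E := Derivation.mk'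
    (AddMonoidHom.toIntLinearMap (AddMonoidHom.mk' D hD.map_add))
    (fun a b => by
      change D (a * b) = a * D b + b * D a
      rw [hD.leibniz]; ring)
  have hD' : ∀ a, D' a = D a := fun a => rfl
  set K := diffSubfieldClosure D (↑F ∪ {u}) with hKdef
  have hFK : F ≤ K := by
    refine le_sInf ?_
    rintro L ⟨hL, -⟩ a ha
    exact hL (Or.inl ha)
  have hKD : ∀ a ∈ K, D' a ∈ K := by
    intro a ha
    rw [hKdef, diffSubfieldClosure, Subfield.mem_sInf] at ha ⊢
    intro L hL
    exact hL.2 a (ha L hL)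
  exact MixedExt.main D' F hF C hC hNNC x hx e he0 he hgen K hFK hKD
end

section
/- Let F be a characteristic-zero differential field whose field of constants C is algebraically closed, and let U ⊇ F be a no-new-constants differential field extension. Suppose there exists x ∈ U ∖ F with x′ ∈ F. Let α_1,…,α_n ∈ C be distinct and let y_1,…,y_n ∈ U be elements satisfying y_i′ = 1/(x+α_i) for each i (note x + α_i ≠ 0 since x ∉ F ⊇ C). Then y_1,…,y_n are algebraically independent over F(x). -/
open Polynomial Differential

set_option linter.unusedSectionVars false

lemma aux_red {L U : Type*} [Field L] [Field U] [Algebra L U]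
    (t : U) (htr : Transcendental L t) (p q : L[X]) (hq : q ≠ 0) :
    ∃ p₁ q₁ : L[X], q₁.Monic ∧ IsCoprime p₁ q₁ ∧
      aeval t p / aeval t q = aeval t p₁ / aeval t q₁ := by
  set r : RatFunc L := algebraMap L[X] (RatFunc L) p / algebraMap L[X] (RatFunc L) q with hr
  refine ⟨r.num, r.denom, r.monic_denom, r.isCoprime_num_denom, ?_⟩
  have h := (RatFunc.num_mul_eq_mul_denom_iff (x := r) (p := p) hq).mpr hr
  have inj := transcendental_iff_injective.mp htr
  have h1 : aeval t q ≠ 0 := (map_ne_zero_iff _ inj).mpr hq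
  have h2 : aeval t r.denom ≠ 0 := (map_ne_zero_iff _ inj).mpr r.denom_ne_zero
  rw [div_eq_div_iff h1 h2, ← map_mul, ← map_mul, h]

section abs

variable {L U : Type*} [Field L] [Field U] [CharZero L] [Algebra L U]
  [Differential L] [Differential U] [DifferentialAlgebra L U]

lemma aux_coeff (a : L) (p : L[X]) (k : ℕ) :
    (implicitDeriv (C a) p).coeff k = (p.coeff k)′ + a * (p.coeff (k+1) * (k+1)) := by
  simp [implicitDeriv, coeff_derivative]

lemma aux_deriv (a : L) (t : U) (ht : t′ = algebraMap L U a) (p : L[X]) :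
    (aeval t p)′ = aeval t (implicitDeriv (C a) p) :=
  deriv_aeval_eq_implicitDeriv t (C a) (by simp [ht]) p

lemma aux_deg (a : L) (q : L[X]) (hq : q.Monic) :
    (implicitDeriv (C a) q).degree < q.degree := by
  rw [degree_eq_natDegree hq.ne_zero, degree_lt_iff_coeff_zero]
  intro m hm
  rw [aux_coeff, coeff_eq_zero_of_natDegree_lt (n := m+1) (by omega)]
  rcases hm.eq_or_lt with h | h
  · rw [← h, hq.coeff_natDegree]; simp
  · rw [coeff_eq_zero_of_natDegree_lt h]; simp

variable [ContainConstants L U]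

/-- if `p_{d-1}' + d p_d a = 0` with `p_d` a nonzero constant, `t` lies in `L`. -/
lemma aux_mem (a : L) (t : U) (ht : t′ = algebraMap L U a) (u v : L) (n : ℕ)
    (hv : v ≠ 0) (hv' : v′ = 0) (h : u′ + a * (v * (n+1)) = 0) :
    t ∈ (algebraMap L U).range := by
  have hn : ((n:L)+1) ≠ 0 := by exact_mod_cast Nat.succ_ne_zero n
  have hw : (v * (n+1))′ = 0 := by
    simp [Derivation.leibniz, hv', map_add]
  have : (algebraMap L U u + algebraMap L U (v * (n+1)) * t)′ = 0 := by
    rw [map_add, Derivation.leibniz, deriv_algebraMap, deriv_algebraMap, hw, ht]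
    simp only [smul_eq_mul, map_zero, mul_zero, add_zero]
    rw [← map_mul, ← map_add, mul_comm _ a, h, map_zero]
  obtain ⟨r, hr⟩ := mem_range_of_deriv_eq_zero L this
  refine ⟨(r - u) / (v * (n+1)), ?_⟩
  have h0 : algebraMap L U (v * (n+1)) ≠ 0 := (map_ne_zero (algebraMap L U)).mpr (mul_ne_zero hv hn)
  rw [map_div₀, div_eq_iff h0, map_sub, hr]; ring

lemma lemA (a : L) (t : U) (ht : t′ = algebraMap L U a) (halg : IsAlgebraic L t) :
    t ∈ (algebraMap L U).range := by
  have hint := halg.isIntegral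
  set p := minpoly L t with hp
  have hm : p.Monic := minpoly.monic hint
  have hd : 0 < p.natDegree := minpoly.natDegree_pos hint
  have h0 : implicitDeriv (C a) p = 0 := by
    by_contra hne
    have := minpoly.degree_le_of_ne_zero L t hne (by
      rw [← aux_deriv a t ht, hp, minpoly.aeval, map_zero])
    exact absurd (aux_deg a p hm) (not_lt.mpr this)
  obtain ⟨n, hn⟩ : ∃ n, p.natDegree = n + 1 := ⟨p.natDegree - 1, by omega⟩
  have h1 : p.coeff (n+1) = 1 := by rw [← hn]; exact hm
  have := aux_coeff a p n
  rw [h0, h1] at this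
  exact aux_mem a t ht (p.coeff n) 1 n one_ne_zero (by simp) (by simpa using this.symm)


lemma aux_quot (a : L) (t : U) (ht : t′ = algebraMap L U a) (p q : L[X]) (z : U)
    (hq : aeval t q ≠ 0) (hz : z = aeval t p / aeval t q) :
    z′ * (aeval t q)^2 =
      aeval t (implicitDeriv (C a) p * q - p * implicitDeriv (C a) q) := by
  have h1 : z * aeval t q = aeval t p := by rw [hz, div_mul_cancel₀ _ hq]
  have h2 := congrArg (fun w => w′) h1
  simp only [Derivation.leibniz, smul_eq_mul, aux_deriv a t ht] at h2
  simp only [map_sub, map_mul]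
  rw [← h1, ← h2]
  ring

lemma lemB (a : L) (t : U) (ht : t′ = algebraMap L U a) (hmem : t ∉ (algebraMap L U).range)
    (p q : L[X]) (z : U) (hz : z = aeval t p / aeval t q) (b : L) (hb : z′ = algebraMap L U b) :
    ∃ c e : L, c′ = 0 ∧ z = algebraMap L U c * t + algebraMap L U e := by
  have htr : Transcendental L t := fun h => hmem (lemA a t ht h)
  have inj := transcendental_iff_injective.mp htr
  by_cases hq : q = 0
  · exact ⟨0, 0, by simp, by simp [hz, hq]⟩
  obtain ⟨p₁, q₁, hm, hc, he⟩ := aux_red t htr p q hq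
  rw [he] at hz
  have hq₁ : aeval t q₁ ≠ 0 := (map_ne_zero_iff _ inj).mpr hm.ne_zero
  have h1 := aux_quot a t ht p₁ q₁ z hq₁ hz
  have h2 : C b * q₁^2 = implicitDeriv (C a) p₁ * q₁ - p₁ * implicitDeriv (C a) q₁ := by
    apply inj
    rw [← h1, hb]; simp
  have h3 : q₁ ∣ implicitDeriv (C a) q₁ := by
    apply hc.symm.dvd_of_dvd_mul_left
    exact ⟨implicitDeriv (C a) p₁ - C b * q₁, by linear_combination h2⟩
  have h4 : implicitDeriv (C a) q₁ = 0 :=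
    eq_zero_of_dvd_of_degree_lt h3 (aux_deg a q₁ hm)
  have h5 : q₁ = 1 := by
    have : (aeval t q₁)′ = 0 := by rw [aux_deriv a t ht, h4, map_zero]
    obtain ⟨r, hr⟩ := mem_range_of_deriv_eq_zero L this
    have : q₁ = C r := inj (by rw [← hr]; simp)
    rw [this] at hm ⊢
    have := hm.leadingCoeff
    rw [leadingCoeff_C] at this
    rw [this, C_1]
  subst h5
  have h6 : implicitDeriv (C a) p₁ = C b := by
    have := h2
    simp at this
    exact this.symm
  have hdeg : p₁.natDegree ≤ 1 := by
    by_contra hlt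
    obtain ⟨n, hn⟩ : ∃ n, p₁.natDegree = n + 2 := ⟨p₁.natDegree - 2, by omega⟩
    have e1 := aux_coeff a p₁ (n+2)
    have e2 := aux_coeff a p₁ (n+1)
    rw [h6, coeff_C_succ] at e1 e2
    rw [coeff_eq_zero_of_natDegree_lt (n := n+2+1) (by omega)] at e1
    refine hmem (aux_mem a t ht (p₁.coeff (n+1)) (p₁.coeff (n+2)) (n+1) ?_ ?_ e2.symm)
    · rw [← hn]
      intro h
      rw [coeff_natDegree, leadingCoeff_eq_zero] at h
      simp [h] at hn
    · simpa using e1.symm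
  have e1 := aux_coeff a p₁ 1
  rw [h6, show (1:ℕ) = 0 + 1 from rfl, coeff_C_succ,
    coeff_eq_zero_of_natDegree_lt (n := 0+1+1) (by omega)] at e1
  refine ⟨p₁.coeff 1, p₁.coeff 0, by simpa using e1.symm, ?_⟩
  rw [hz]
  conv_lhs => rw [eq_X_add_C_of_natDegree_le_one hdeg]
  simp

lemma lemP (a : L) (t : U) (ht : t′ = algebraMap L U a) (hmem : t ∉ (algebraMap L U).range)
    (p q r s : L[X]) (z : U) (hz : z = aeval t p / aeval t q) (c β : L) (hβ : β′ = 0)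
    (hs : s.eval β ≠ 0)
    (hb : z′ = algebraMap L U c / (t - algebraMap L U β) + aeval t r / aeval t s) :
    c = 0 := by
  have htr : Transcendental L t := fun h => hmem (lemA a t ht h)
  have inj := transcendental_iff_injective.mp htr
  have ha : a ≠ 0 := by
    rintro rfl
    exact hmem (mem_range_of_deriv_eq_zero L (by simpa using ht))
  have hs0 : s ≠ 0 := by rintro rfl; simp at hs
  have hst : aeval t s ≠ 0 := (map_ne_zero_iff _ inj).mpr hs0
  have htβ : t - algebraMap L U β ≠ 0 := by
    intro h; exact hmem ⟨β, (sub_eq_zero.mp h).symm⟩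
  obtain ⟨p₁, q₁, hm, hc, hz⟩ : ∃ p₁ q₁ : L[X], q₁.Monic ∧ IsCoprime p₁ q₁ ∧
      z = aeval t p₁ / aeval t q₁ := by
    by_cases hq : q = 0
    · exact ⟨0, 1, monic_one, isCoprime_one_right, by simp [hz, hq]⟩
    · rw [hz]; exact aux_red t htr p q hq
  have hq₁ : aeval t q₁ ≠ 0 := (map_ne_zero_iff _ inj).mpr hm.ne_zero
  have h1 := aux_quot a t ht p₁ q₁ z hq₁ hz
  have h2 : (implicitDeriv (C a) p₁ * q₁ - p₁ * implicitDeriv (C a) q₁) * s * (X - C β) =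
      q₁^2 * (C c * s + r * (X - C β)) := by
    apply inj
    rw [map_mul, map_mul, ← h1, hb]
    simp only [map_mul, map_add, map_sub, map_pow, aeval_X, aeval_C]
    field_simp
  obtain ⟨u, hu, hnd⟩ := exists_eq_pow_rootMultiplicity_mul_and_not_dvd q₁ hm.ne_zero β
  generalize rootMultiplicity β q₁ = m at hu
  have hu0 : u.eval β ≠ 0 := by rwa [dvd_iff_isRoot] at hnd
  have hder : implicitDeriv (C a) (X - C β) = C a := by simp [hβ]
  rcases m with _ | m
  · have := congrArg (eval β) h2
    simp at hu
    simp [hu, hs, hu0] at this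
    exact this
  · exfalso
    have hl : (X - C β : L[X]) ≠ 0 := X_sub_C_ne_zero β
    have hp : p₁.eval β ≠ 0 := by
      intro h0
      have d1 : (X - C β) ∣ p₁ := dvd_iff_isRoot.mpr h0
      have d2 : (X - C β) ∣ q₁ := by rw [hu, pow_succ]; exact ⟨(X - C β)^m * u, by ring⟩
      exact not_isUnit_X_sub_C β (hc.isUnit_of_dvd' d1 d2)
    have hq' : implicitDeriv (C a) q₁ =
        (X - C β)^m * (((m:L[X])+1) * C a * u + (X - C β) * implicitDeriv (C a) u) := by
      rw [hu, Derivation.leibniz, Derivation.leibniz_pow, hder]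
      simp
      ring
    rw [hq'] at h2
    have h3 : (X - C β)^(m+1) * ((implicitDeriv (C a) p₁ * ((X - C β) * u)
        - p₁ * (((m:L[X])+1) * C a * u + (X - C β) * implicitDeriv (C a) u)) * s) =
        (X - C β)^(m+1) * ((X - C β)^(m+1) * u^2 * (C c * s + r * (X - C β))) := by
      have := h2
      rw [hu] at this
      linear_combination this
    have h4 := congrArg (eval β) (mul_left_cancel₀ (pow_ne_zero _ hl) h3)
    have hm1 : ((m:L)+1) ≠ 0 := by exact_mod_cast Nat.succ_ne_zero m
    simp [hp, ha, hu0, hs, hm1] at h4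

end abs

section wrap

variable {U : Type*} [Field U]

/-- The bundled derivation on `U`. -/
noncomputable abbrev diffU {D : U → U} (hD : IsDerivation D) : Differential U where
  deriv := Derivation.mk' (AddMonoidHom.mk' D hD.map_add).toIntLinearMap (by
    intro a b
    simp [hD.leibniz]
    ring)

/-- The bundled derivation on a stable subfield. -/
noncomputable abbrev diffL {D : U → U} (hD : IsDerivation D) (L : Subfield U)
    (hL : ∀ a ∈ L, D a ∈ L) : Differential L where
  deriv := Derivation.mk' (AddMonoidHom.mk' (fun a : L => (⟨D a, hL a a.2⟩ : L)) (by
    intro a b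
    ext
    simp [hD.map_add])).toIntLinearMap (by
    intro a b
    ext
    simp [hD.leibniz]
    ring)

lemma mem_closure_frac (L : Subfield U) (t z : U) (hz : z ∈ Subfield.closure (↑L ∪ {t})) :
    ∃ p q : L[X], z = aeval t p / aeval t q := by
  apply (IntermediateField.mem_adjoin_simple_iff L z).mp
  rw [← IntermediateField.mem_toSubfield, IntermediateField.adjoin_toSubfield]
  convert hz
  ext w
  exact ⟨fun ⟨r, hr⟩ => hr ▸ r.2, fun hw => ⟨⟨w, hw⟩, rfl⟩⟩

variable {D : U → U}

lemma wA [CharZero U] (hD : IsDerivation D) (L : Subfield U)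
    (hL : ∀ a ∈ L, D a ∈ L) (hNNC : ∀ a : U, D a = 0 → a ∈ L)
    (t : U) (ht : D t ∈ L) (h : IsAlgebraic L t) : t ∈ L := by
  let _ := diffU hD
  let _ := diffL hD L hL
  have : DifferentialAlgebra L U := ⟨fun a => rfl⟩
  have : ContainConstants L U := ⟨fun {a} h => ⟨⟨a, hNNC a h⟩, rfl⟩⟩
  obtain ⟨r, rfl⟩ := lemA (L := L) ⟨D t, ht⟩ t rfl h
  exact r.2

lemma wB [CharZero U] (hD : IsDerivation D) (L : Subfield U)
    (hL : ∀ a ∈ L, D a ∈ L) (hNNC : ∀ a : U, D a = 0 → a ∈ L)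
    (t : U) (ht : D t ∈ L) (htL : t ∉ L) (z : U) (hz : z ∈ Subfield.closure (↑L ∪ {t}))
    (hzL : D z ∈ L) : ∃ c, D c = 0 ∧ z - c * t ∈ L := by
  let _ := diffU hD
  let _ := diffL hD L hL
  have : DifferentialAlgebra L U := ⟨fun a => rfl⟩
  have : ContainConstants L U := ⟨fun {a} h => ⟨⟨a, hNNC a h⟩, rfl⟩⟩
  obtain ⟨p, q, h⟩ := mem_closure_frac L t z hz
  obtain ⟨c, e, hc, he⟩ := lemB (L := L) ⟨D t, ht⟩ t rfl
    (by rintro ⟨r, rfl⟩; exact htL r.2) p q z h ⟨D z, hzL⟩ rfl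
  refine ⟨c, congrArg Subtype.val hc, ?_⟩
  rw [he]
  have : algebraMap L U c * t + algebraMap L U e - c * t = e := by
    change (c:U) * t + e - c * t = e
    ring
  rw [this]
  exact e.2

lemma wP [CharZero U] (hD : IsDerivation D) (L : Subfield U)
    (hL : ∀ a ∈ L, D a ∈ L) (hNNC : ∀ a : U, D a = 0 → a ∈ L)
    {ι : Type*} (t : U) (ht : D t ∈ L) (htL : t ∉ L) (z : U)
    (hz : z ∈ Subfield.closure (↑L ∪ {t})) (α : ι → U) (hα : ∀ i, D (α i) = 0)
    (hinj : Function.Injective α) (i : ι) (s : Finset ι) (hi : i ∉ s)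
    (c : U) (hc : D c = 0) (b : ι → U) (hb : ∀ j, D (b j) = 0)
    (h : D z = c / (t + α i) + ∑ j ∈ s, b j / (t + α j)) : c = 0 := by
  let _ := diffU hD
  let _ := diffL hD L hL
  have : DifferentialAlgebra L U := ⟨fun a => rfl⟩
  have : ContainConstants L U := ⟨fun {a} h => ⟨⟨a, hNNC a h⟩, rfl⟩⟩
  obtain ⟨p, q, hpq⟩ := mem_closure_frac L t z hz
  let A : ι → L := fun i => ⟨α i, hNNC _ (hα i)⟩
  let B : ι → L := fun i => ⟨b i, hNNC _ (hb i)⟩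
  have hne : ∀ w : L, t + w ≠ 0 := by
    intro w hw
    apply htL
    rw [eq_neg_of_add_eq_zero_left hw]
    exact L.neg_mem w.2
  have key : ∀ s : Finset ι, i ∉ s → ∃ r s' : L[X], s'.eval (-(A i)) ≠ 0 ∧ aeval t s' ≠ 0 ∧
      ∑ j ∈ s, b j / (t + α j) = aeval t r / aeval t s' := by
    classical
    intro s
    induction s using Finset.induction_on with
    | empty => intro _; exact ⟨0, 1, by simp, by simp, by simp⟩
    | insert j s hj ih =>
      intro hi
      obtain ⟨r, s', h1, h2, h3⟩ := ih (fun h => hi (Finset.mem_insert_of_mem h))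
      have e : aeval t (X + C (A j)) = t + α j := by
        rw [map_add, aeval_X, aeval_C]; rfl
      have e' : aeval t (C (B j)) = b j := by
        rw [aeval_C]; rfl
      have hn : t + α j ≠ 0 := hne (A j)
      refine ⟨C (B j) * s' + r * (X + C (A j)), (X + C (A j)) * s', ?_, ?_, ?_⟩
      · rw [eval_mul]
        refine mul_ne_zero ?_ h1
        simp only [eval_add, eval_X, eval_C]
        intro h0
        have : A j = A i := by linear_combination h0
        have := hinj (congrArg Subtype.val this)
        subst this
        simp at hi
      · rw [map_mul, e]
        exact mul_ne_zero hn h2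
      · rw [Finset.sum_insert hj, h3, map_add, map_mul, map_mul, map_mul, e, e']
        field_simp
  obtain ⟨r, s', h1, h2, h3⟩ := key s hi
  have := lemP (L := L) ⟨D t, ht⟩ t rfl
    (by rintro ⟨r, rfl⟩; exact htL r.2) p q r s' z hpq ⟨c, hNNC c hc⟩ (-(A i))
    (by rw [map_neg, neg_eq_zero]; exact Subtype.ext (hα i)) h1 (by
      have e : t - algebraMap L U (-(A i)) = t + α i := by
        rw [map_neg, sub_neg_eq_add]; rfl
      rw [e, ← h3]
      exact h)
  exact congrArg Subtype.val this

lemma closure_stable (hD : IsDerivation D) (L : Subfield U)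
    (hL : ∀ a ∈ L, D a ∈ L)
    (S : Set U) (hS : ∀ a ∈ S, D a ∈ Subfield.closure (↑L ∪ S)) :
    ∀ a ∈ Subfield.closure (↑L ∪ S), D a ∈ Subfield.closure (↑L ∪ S) := by
  let _ := diffU hD
  have hDe : ∀ a : U, D a = a′ := fun a => rfl
  intro a ha
  induction ha using Subfield.closure_induction with
  | mem a h =>
    rcases h with h | h
    · exact Subfield.subset_closure (Or.inl (hL a h))
    · exact hS a h
  | one => rw [hDe]; simp
  | add a b _ _ h1 h2 => rw [hD.map_add]; exact add_mem h1 h2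
  | neg a _ h => rw [hDe, map_neg]; exact neg_mem h
  | inv a ha h =>
    rw [hDe, Derivation.leibniz_inv, smul_eq_mul]
    exact mul_mem (neg_mem (pow_mem (inv_mem ha) 2)) h
  | mul a b ha hb h1 h2 => rw [hD.leibniz]; exact add_mem (mul_mem h1 hb) (mul_mem ha h2)

/-- Elements of `L(y_s)` with derivative in `L` are linear combinations modulo `L`. -/
lemma ostrowski_s13 [CharZero U] (hD : IsDerivation D) (L : Subfield U)
    (hL : ∀ a ∈ L, D a ∈ L) (hNNC : ∀ a : U, D a = 0 → a ∈ L)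
    {ι : Type*} (y : ι → U) (hy : ∀ i, D (y i) ∈ L) (s : Finset ι) :
    ∀ z ∈ Subfield.closure (↑L ∪ y '' s), D z ∈ L →
      ∃ c : ι → U, (∀ i, D (c i) = 0) ∧ z - ∑ i ∈ s, c i * y i ∈ L := by
  classical
  let _ := diffU hD
  have hDe : ∀ a : U, D a = a′ := fun a => rfl
  have hD0 : D 0 = 0 := by rw [hDe, map_zero]
  induction s using Finset.induction_on with
  | empty =>
    intro z hz _
    refine ⟨0, fun i => hD0, ?_⟩
    simpa using hz
  | insert j s hj ih =>
    intro z hz hzL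
    set M := Subfield.closure (↑L ∪ y '' s) with hM
    have hLM : L ≤ M := fun a ha => Subfield.subset_closure (Or.inl ha)
    have hMs : ∀ a ∈ M, D a ∈ M := by
      apply closure_stable hD L hL
      rintro _ ⟨i, _, rfl⟩
      exact hLM (hy i)
    have hz' : z ∈ Subfield.closure (↑M ∪ {y j}) := by
      refine (Subfield.closure_le.mpr ?_) hz
      rintro w (hw | ⟨i, hi, rfl⟩)
      · exact Subfield.subset_closure (Or.inl (hLM hw))
      · rcases Finset.mem_insert.mp hi with rfl | hi
        · exact Subfield.subset_closure (Or.inr rfl)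
        · exact Subfield.subset_closure (Or.inl (Subfield.subset_closure (Or.inr ⟨i, hi, rfl⟩)))
    obtain ⟨c, hc, hcz⟩ : ∃ c, D c = 0 ∧ z - c * y j ∈ M := by
      by_cases hjM : y j ∈ M
      · refine ⟨0, hD0, ?_⟩
        have : Subfield.closure (↑M ∪ {y j}) ≤ M := by
          rw [Subfield.closure_le]
          rintro w (hw | rfl)
          · exact hw
          · exact hjM
        simpa using this hz'
      · exact wB hD M hMs (fun a ha => hLM (hNNC a ha)) (y j) (hLM (hy j)) hjM z hz' (hLM hzL)
    obtain ⟨b, hb, hbz⟩ := ih (z - c * y j) hcz (by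
      have : D (z - c * y j) = D z - c * D (y j) := by
        have h1 := hD.leibniz c (y j)
        rw [hc, zero_mul, zero_add] at h1
        rw [← h1, hDe, hDe, hDe, map_sub]
      rw [this]
      exact sub_mem hzL (mul_mem (hNNC c hc) (hy j)))
    refine ⟨fun i => if i = j then c else b i, ?_, ?_⟩
    · intro i
      dsimp only
      split_ifs
      · exact hc
      · exact hb i
    · rw [Finset.sum_insert hj]
      have : ∑ i ∈ s, (if i = j then c else b i) * y i = ∑ i ∈ s, b i * y i := by
        refine Finset.sum_congr rfl fun i hi => ?_
        rw [if_neg (by rintro rfl; exact hj hi)]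
      rw [this]
      simp only [if_true]
      rw [← sub_sub]
      exact hbz

end wrap


/-- Let `F` be a characteristic-zero differential field whose field of constants `C`
is algebraically closed, and let `U ⊇ F` be a no-new-constants extension.  Suppose
`x ∈ U \ F` satisfies `x' ∈ F`, let `α₁, …, αₙ ∈ C` be distinct, and let
`y₁, …, yₙ ∈ U` satisfy `yᵢ' = 1/(x + αᵢ)`.  Then `y₁, …, yₙ` are algebraically
independent over `F(x)`. -/
theorem antiderivatives_of_simple_poles_algebraically_independent
    {U : Type*} [Field U] [CharZero U]
    (D : U → U) (hD : IsDerivation D)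
    (F : Subfield U) (hF : ∀ a ∈ F, D a ∈ F)
    (C : Subfield U) (hC : ∀ c : U, c ∈ C ↔ (c ∈ F ∧ D c = 0))
    [IsAlgClosed C]
    (hNNC : ∀ a : U, D a = 0 → a ∈ F)
    (x : U) (hx : D x ∈ F) (hxF : x ∉ F)
    {n : ℕ} (α : Fin n → U) (hα : ∀ i, α i ∈ C) (hαinj : Function.Injective α)
    (y : Fin n → U) (hy : ∀ i, D (y i) = 1 / (x + α i)) :
    AlgebraicIndependent (Subfield.closure (↑F ∪ {x})) y := by
  classical
  let _ := diffU hD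
  have hDe : ∀ a : U, D a = a′ := fun a => rfl
  set K := Subfield.closure (↑F ∪ {x}) with hK
  have hFK : F ≤ K := fun a ha => Subfield.subset_closure (Or.inl ha)
  have hxK : x ∈ K := Subfield.subset_closure (Or.inr rfl)
  have hKs : ∀ a ∈ K, D a ∈ K := by
    apply closure_stable hD F hF
    rintro _ rfl
    exact hFK hx
  have hKc : ∀ a : U, D a = 0 → a ∈ K := fun a ha => hFK (hNNC a ha)
  have hα0 : ∀ i, D (α i) = 0 := fun i => ((hC _).mp (hα i)).2
  have hyK : ∀ i, D (y i) ∈ K := by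
    intro i
    rw [hy i]
    exact div_mem (one_mem _) (add_mem hxK (hKc _ (hα0 i)))
  apply algebraicIndependent_of_finite_type' (algebraMap K U).injective
  intro t htf _ i hit halg
  obtain ⟨s, rfl⟩ := htf.exists_finset_coe
  set M := Subfield.closure (↑K ∪ y '' s) with hM
  have hKM : K ≤ M := fun a ha => Subfield.subset_closure (Or.inl ha)
  have hMs : ∀ a ∈ M, D a ∈ M := by
    apply closure_stable hD K hKs
    rintro _ ⟨i, _, rfl⟩
    exact hKM (hyK i)
  have hsub : ∀ w ∈ Algebra.adjoin K (y '' s), w ∈ M := by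
    intro w hw
    induction hw using Algebra.adjoin_induction with
    | mem w hw => exact Subfield.subset_closure (Or.inr hw)
    | algebraMap r => exact hKM r.2
    | add a b _ _ h1 h2 => exact add_mem h1 h2
    | mul a b _ _ h1 h2 => exact mul_mem h1 h2
  have halgM : IsAlgebraic M (y i) := by
    let f : Algebra.adjoin K (y '' s) →+* M :=
      (Algebra.adjoin K (y '' s)).val.toRingHom.codRestrict M (fun w => hsub w w.2)
    obtain ⟨p, hp, hp0⟩ := halg
    have hf : Function.Injective f := fun a b h => by
      have h' : ((f a : M) : U) = ((f b : M) : U) := by rw [h]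
      exact Subtype.ext h'
    refine ⟨p.map f, (Polynomial.map_ne_zero_iff hf).mpr hp, ?_⟩
    rw [aeval_def, eval₂_map]
    exact hp0
  have hyM : y i ∈ M :=
    wA hD M hMs (fun a ha => hKM (hKc a ha)) (y i) (hKM (hyK i)) halgM
  obtain ⟨c, hc, hcz⟩ := ostrowski_s13 hD K hKs hKc y hyK s (y i) hyM (hyK i)
  refine one_ne_zero (α := U) (wP hD F hF hNNC x hx hxF _ hcz α hα0 hαinj i s
    (by simpa using hit) 1 (by rw [hDe]; simp) (fun j => - c j)
    (fun j => by rw [hDe, map_neg, ← hDe, hc, neg_zero]) ?_)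
  rw [hDe, map_sub, map_sum, ← hDe, hy, sub_eq_add_neg, ← Finset.sum_neg_distrib]
  congr 1
  refine Finset.sum_congr rfl fun j _ => ?_
  rw [← hDe, hD.leibniz, hc, hy]
  ring
end

section
/- Let F be a characteristic-zero differential field whose field of constants C is algebraically closed, let U ⊇ F be a no-new-constants differential field extension, and let x_1,…,x_l ∈ U satisfy x_i′ ∈ F and be algebraically independent over F. For each i = 1,…,m let A_i, B_i, C_i ∈ F[x_1,…,x_l] be polynomials with (A_i,B_i) = (A_i,C_i) = (B_i,C_i) = 1 which satisfy condition C1: each C_i is irreducible, C_i does not divide C_j for i ≠ j (they are non-associate), and C_i does not divide B_j for any i, j. Let y_1,…,y_m ∈ U satisfy y_i′ = A_i/(C_i·B_i). Then y_1,…,y_m are algebraically independent over F(x_1,…,x_l). -/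
open MvPolynomial

theorem exists_poly_deriv {U : Type*} [Field U] (d : Derivation ℤ U U) (L : Subfield U)
    (hL : ∀ a ∈ L, d a ∈ L) {n : ℕ} (z : Fin n → U) (b : Fin n → L)
    (hb : ∀ i, d (z i) = b i) :
    ∃ δ : MvPolynomial (Fin n) L → MvPolynomial (Fin n) L,
      (∀ P, aeval z (δ P) = d (aeval z P)) ∧
      (∀ P t, ((coeff t (δ P) : L) : U) = d (coeff t P : L) +
        ∑ i, ((t i : U) + 1) * (coeff (t + Finsupp.single i 1) P : L) * b i) := by
  classical
  let dL : L → L := fun a => ⟨d a, hL a a.2⟩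
  let M : MvPolynomial (Fin n) L → MvPolynomial (Fin n) L :=
    fun P => ∑ t ∈ P.support, monomial t (dL (coeff t P))
  have hM : ∀ P t, coeff t (M P) = dL (coeff t P) := by
    intro P t
    simp only [M, coeff_sum, coeff_monomial]
    rw [Finset.sum_ite_eq' P.support t]
    split_ifs with h
    · rfl
    · rw [notMem_support_iff.mp h]
      ext; simp [dL]
  have hMadd : ∀ P Q, M (P + Q) = M P + M Q := by
    intro P Q; ext t; simp [hM, dL]
  have hMC : ∀ a, M (C a) = C (dL a) := by
    intro a; ext t; rw [hM, coeff_C, coeff_C]; split_ifs <;> simp [dL]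
  have hMX : ∀ P i, M (P * X i) = M P * X i := by
    intro P i; ext t; rw [hM, coeff_mul_X', coeff_mul_X', hM]; split_ifs <;> simp [dL]
  refine ⟨fun P => M P + ∑ i, pderiv i P * C (b i), ?_, ?_⟩
  · intro P
    induction P using MvPolynomial.induction_on with
    | C a => simp [hMC, dL]; rfl
    | add p q hp hq =>
      beta_reduce at hp hq ⊢
      rw [hMadd, map_add (aeval z) p q, map_add d, ← hp, ← hq, ← map_add (aeval z)]
      congr 1
      simp only [map_add, add_mul, Finset.sum_add_distrib]; ring
    | mul_X p i hp =>
      beta_reduce at hp ⊢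
      have : M (p * X i) + ∑ j, pderiv j (p * X i) * C (b j)
          = (M p + ∑ j, pderiv j p * C (b j)) * X i + p * C (b i) := by
        have h2 : ∑ j, p * Pi.single (M := fun _ => MvPolynomial (Fin n) L) i 1 j * C (b j)
            = p * C (b i) := by
          rw [Finset.sum_eq_single i]
          · simp
          · intro j _ hj; simp [hj]
          · simp
        rw [hMX, add_mul, Finset.sum_mul Finset.univ, add_assoc, ← h2, ← Finset.sum_add_distrib]
        congr 1
        refine Finset.sum_congr rfl fun j _ => ?_
        rw [Derivation.leibniz, pderiv_X]
        simp only [smul_eq_mul]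
        have : (Pi.single i 1 : Fin n → MvPolynomial (Fin n) L) j =
            (Pi.single j 1 : Fin n → MvPolynomial (Fin n) L) i := by
          simp [Pi.single_apply, eq_comm]
        rw [← this]
        ring
      rw [this, map_add, map_mul, hp, map_mul, map_mul, aeval_X, d.leibniz, hb, aeval_C]
      simp only [smul_eq_mul]
      change _ + _ * (b i : U) = _
      ring
  · intro P t
    rw [coeff_add, hM, coeff_sum]
    push_cast
    congr 1
    refine Finset.sum_congr rfl fun i _ => ?_
    rw [mul_comm, coeff_C_mul, coeff_pderiv]
    push_cast
    ring

theorem not_dvd_deriv {U : Type*} [Field U] (d : Derivation ℤ U U) (L : Subfield U)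
    (hconst : ∀ a, d a = 0 → a ∈ L) {n : ℕ} (z : Fin n → U)
    (hz : AlgebraicIndependent L z) (b : Fin n → L)
    (δ : MvPolynomial (Fin n) L → MvPolynomial (Fin n) L)
    (h1 : ∀ P, aeval z (δ P) = d (aeval z P))
    (h2 : ∀ P t, ((coeff t (δ P) : L) : U) = d (coeff t P : L) +
        ∑ i, ((t i : U) + 1) * (coeff (t + Finsupp.single i 1) P : L) * b i)
    (p : MvPolynomial (Fin n) L) (hp : Irreducible p) : ¬ p ∣ δ p := by
  rintro ⟨a, ha⟩
  have hp0 := hp.ne_zero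
  let m : MonomialOrder (Fin n) := MonomialOrder.degLex
  have hlt : ∀ t i, m.toSyn t < m.toSyn (t + Finsupp.single i 1) := by
    intro t i
    apply m.toSyn_strictMono
    refine lt_add_of_pos_right _ ?_
    rw [pos_iff_ne_zero]
    simp
  have hc : ∀ t, m.toSyn (m.degree p) ≤ m.toSyn t →
      ((coeff t (δ p) : L) : U) = d (coeff t p : L) := by
    intro t ht
    rw [h2, Finset.sum_eq_zero, add_zero]
    intro i _
    rw [m.coeff_eq_zero_of_lt (lt_of_le_of_lt ht (hlt t i))]
    simp
  have hdeg : m.toSyn (m.degree (δ p)) ≤ m.toSyn (m.degree p) := by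
    rw [m.degree_le_iff]
    intro t ht
    by_contra hcon
    push Not at hcon
    apply mem_support_iff.mp ht
    have := hc t hcon.le
    rw [m.coeff_eq_zero_of_lt hcon] at this
    simpa using this
  have haC : ∃ e : L, a = C e := by
    by_cases ha0 : a = 0
    · exact ⟨0, by simp [ha0]⟩
    rw [ha, m.degree_mul hp0 ha0, map_add] at hdeg
    have : m.toSyn (m.degree a) = 0 :=
      le_antisymm (by simpa using hdeg) (m.zero_le _)
    have : m.degree a = 0 := by simpa using this
    exact ⟨_, m.eq_C_of_degree_eq_zero this⟩
  obtain ⟨e, rfl⟩ := haC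
  set c : L := coeff (m.degree p) p with hcdef
  have hc0 : c ≠ 0 := m.coeff_degree_ne_zero_iff.mpr hp0
  have hcU : (c : U) ≠ 0 := by simpa using hc0
  have hdc : d (c : U) = c * e := by
    rw [← hc _ le_rfl, ha, mul_comm, coeff_C_mul]; simp [c, mul_comm]
  have hdp : d (aeval z p) = aeval z p * e := by
    rw [← h1, ha, map_mul, aeval_C]; rfl
  have hq : d (aeval z p / (c : U)) = 0 := by
    rw [Derivation.leibniz_div, hdc, hdp]
    simp only [smul_eq_mul]; ring
  have hmem := hconst _ hq
  have : p = C (⟨_, hmem⟩ * c) := by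
    apply hz
    rw [aeval_C]
    change _ = (aeval z p / (c : U)) * c
    field_simp
  apply hp.not_isUnit
  rw [this] at hp0 ⊢
  refine IsUnit.map C (IsUnit.mk0 _ ?_)
  intro h; rw [h] at hp0; simp at hp0

theorem no_simple_pole {U : Type*} [Field U] [CharZero U] (d : Derivation ℤ U U) (L : Subfield U)
    {n : ℕ} (z : Fin n → U) (hz : AlgebraicIndependent L z)
    (δ : MvPolynomial (Fin n) L → MvPolynomial (Fin n) L)
    (h1 : ∀ P, aeval z (δ P) = d (aeval z P))
    (p : MvPolynomial (Fin n) L) (hp : Irreducible p) (hpd : ¬ p ∣ δ p)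
    (g : U) (P₀ Q₀ : MvPolynomial (Fin n) L) (hg : g = aeval z P₀ / aeval z Q₀)
    (q r : MvPolynomial (Fin n) L) (hq : ¬ p ∣ q) (hr : ¬ p ∣ r)
    (h : aeval z q * aeval z p * d g = aeval z r) : False := by
  classical
  have hpr : Prime p := hp.prime
  have hex : ∃ k : ℕ, ∃ P Q : MvPolynomial (Fin n) L, ¬ p ∣ Q ∧
      g * aeval z p ^ k * aeval z Q = aeval z P := by
    by_cases hQ : Q₀ = 0
    · refine ⟨0, 0, 1, fun h => hp.not_isUnit (isUnit_of_dvd_one h), ?_⟩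
      simp [hg, hQ]
    · obtain ⟨Q, hQ1, hQ2⟩ :=
        (FiniteMultiplicity.of_not_isUnit hp.not_isUnit hQ).exists_eq_pow_mul_and_not_dvd
      refine ⟨multiplicity p Q₀, P₀, Q, hQ2, ?_⟩
      rw [mul_assoc, ← map_pow, ← map_mul, ← hQ1, hg, div_mul_cancel₀]
      intro h0
      exact hQ (hz (by simpa using h0))
  have hmin := fun k (hk : k < Nat.find hex) => Nat.find_min hex hk
  obtain ⟨P, Q, hQ, hgPQ⟩ := Nat.find_spec hex
  set k := Nat.find hex with hk
  clear_value k
  have hd := congrArg d hgPQ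
  rw [d.leibniz, d.leibniz, d.leibniz_pow, ← h1, ← h1, ← h1] at hd
  simp only [smul_eq_mul, nsmul_eq_mul] at hd
  have hpi : aeval z p ≠ 0 := fun h0 => hp.ne_zero (hz (by simpa using h0))
  rcases k with _ | k
  · have : p ∣ r * (Q * Q) := by
      refine ⟨q * δ P * Q - q * P * δ Q, ?_⟩
      apply hz
      simp only [map_mul, map_sub]
      rw [← h, ← hd, ← hgPQ]
      simp
      ring
    rcases hpr.dvd_or_dvd this with h | h
    · exact hr h
    · rcases hpr.dvd_or_dvd h with h | h <;> exact hQ h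
  · have hP : ¬ p ∣ P := by
      rintro ⟨P1, rfl⟩
      refine hmin k (Nat.lt_succ_self k) ⟨P1, Q, hQ, ?_⟩
      apply mul_left_cancel₀ hpi
      rw [← map_mul, ← hgPQ]
      ring
    have : p ∣ C ((k + 1 : ℕ) : L) * (q * Q * δ p * P) := by
      refine ⟨δ P * q * Q - P * δ Q * q - r * p ^ k * (Q * Q), ?_⟩
      apply hz
      have e : aeval z (C ((k + 1 : ℕ) : L)) = ((k + 1 : ℕ) : U) := by
        simp
      simp only [map_mul, map_sub, map_pow]
      rw [e, ← h, ← hd, ← hgPQ, Nat.add_sub_cancel]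
      ring
    have hu : IsUnit (C ((k + 1 : ℕ) : L) : MvPolynomial (Fin n) L) :=
      IsUnit.map C (IsUnit.mk0 _ (Nat.cast_ne_zero.mpr (Nat.succ_ne_zero k)))
    rw [hu.dvd_mul_left] at this
    rcases hpr.dvd_or_dvd this with h | h
    · rcases hpr.dvd_or_dvd h with h | h
      · rcases hpr.dvd_or_dvd h with h | h
        · exact hq h
        · exact hQ h
      · exact hpd h
    · exact hP h

/-- Ostrowski's theorem. -/
theorem ostrowski_s14 {U : Type*} [Field U] [CharZero U] (d : Derivation ℤ U U) (L : Subfield U)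
    (hL : ∀ a ∈ L, d a ∈ L) {n : ℕ} (z : Fin n → U) (hz : ∀ i, d (z i) ∈ L)
    (hdep : ¬ AlgebraicIndependent L z) :
    ∃ c : Fin n → U, (∀ i, d (c i) = 0) ∧ (∃ i, c i ≠ 0) ∧
      ∃ g ∈ L, ∑ i, c i * d (z i) = d g := by
  classical
  obtain ⟨δ, h1, h2⟩ := exists_poly_deriv d L hL z (fun i => ⟨_, hz i⟩) (fun i => rfl)
  let m : MonomialOrder (Fin n) := MonomialOrder.degLex
  have hdl : ∀ s t : Fin n →₀ ℕ, s.degree < t.degree → m.toSyn s < m.toSyn t := by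
    intro s t hst
    change toDegLex s < toDegLex t
    rw [Finsupp.DegLex.lt_iff]
    exact Or.inl hst
  let S : Set (MvPolynomial (Fin n) L) := {P | P ≠ 0 ∧ aeval z P = 0}
  have hS : S.Nonempty := by
    by_contra hcon
    apply hdep
    rw [algebraicIndependent_iff]
    intro P hP
    by_contra h0
    exact hcon ⟨P, h0, hP⟩
  let wf := InvImage.wf (fun P : MvPolynomial (Fin n) L => m.toSyn (m.degree P))
    (wellFounded_lt : WellFounded ((· < ·) : m.syn → m.syn → Prop))
  obtain ⟨P₁, hP₁, hP₁min⟩ := wf.has_min S hS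
  obtain ⟨hP₁0, hP₁z⟩ := hP₁
  set a : L := coeff (m.degree P₁) P₁ with hadef
  have ha0 : a ≠ 0 := m.coeff_degree_ne_zero_iff.mpr hP₁0
  set P : MvPolynomial (Fin n) L := C a⁻¹ * P₁ with hPdef
  set s := m.degree P₁ with hs
  have hPs : coeff s P = 1 := by
    rw [hPdef, coeff_C_mul, ← hadef, inv_mul_cancel₀ ha0]
  have hPz : aeval z P = 0 := by rw [hPdef, map_mul, hP₁z, mul_zero]
  have hPt : ∀ t, m.toSyn s < m.toSyn t → coeff t P = 0 := by
    intro t ht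
    rw [hPdef, coeff_C_mul, m.coeff_eq_zero_of_lt ht, mul_zero]
  have hlt : ∀ t i, m.toSyn t < m.toSyn (t + Finsupp.single i 1) := by
    intro t i
    apply hdl
    simp
  have hδ : δ P = 0 := by
    by_contra h0
    refine hP₁min (δ P) ⟨h0, by rw [h1, hPz, map_zero]⟩ ?_
    change m.toSyn (m.degree (δ P)) < m.toSyn s
    by_contra hle
    push Not at hle
    refine m.coeff_degree_ne_zero_iff.mpr h0 ?_
    have := h2 P (m.degree (δ P))
    rw [Finset.sum_eq_zero, add_zero] at this
    · rcases hle.eq_or_lt with he | hl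
      · have he : s = m.degree (δ P) := m.toSyn.injective he
        rw [← he, hPs] at this
        rw [← he]
        simpa using this
      · rw [hPt _ hl] at this
        simpa using this
    · intro i _
      rw [hPt _ (hle.trans_lt (hlt _ i))]
      simp
  have hs0 : s ≠ 0 := by
    intro h0
    have hC := m.eq_C_of_degree_eq_zero (f := P₁) h0
    rw [hC, aeval_C] at hP₁z
    apply hP₁0
    rw [hC]
    have : m.leadingCoeff P₁ = 0 := by simpa using hP₁z
    rw [this, map_zero]
  obtain ⟨i, hi⟩ : ∃ i, s i ≠ 0 := by
    by_contra hcon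
    push Not at hcon
    exact hs0 (Finsupp.ext hcon)
  set u := s - Finsupp.single i 1 with hu
  have hui : u + Finsupp.single i 1 = s := by
    rw [hu]
    apply tsub_add_cancel_of_le
    simpa using Nat.one_le_iff_ne_zero.mpr hi
  have hud : u.degree + 1 = s.degree := by
    rw [← hui]; simp
  refine ⟨fun j => ((u j : U) + 1) * (coeff (u + Finsupp.single j 1) P : L), ?_, ⟨i, ?_⟩,
    -(coeff u P : L), ?_, ?_⟩
  · intro j
    have hz0 : d (coeff (u + Finsupp.single j 1) P : L) = 0 := by
      have := h2 P (u + Finsupp.single j 1)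
      rw [Finset.sum_eq_zero, add_zero, hδ] at this
      · simpa using this.symm
      · intro i _
        rw [hPt _ (hdl _ _ (by simp; omega))]
        simp
    rw [d.leibniz, hz0]
    simp
  · beta_reduce
    rw [hui, hPs]
    simpa using Nat.cast_add_one_ne_zero (u i)
  · exact L.neg_mem (coeff u P).2
  · have := h2 P u
    rw [hδ] at this
    rw [map_neg, eq_neg_iff_add_eq_zero, add_comm]
    simpa using this.symm

/-- Let `F` be a characteristic-zero differential field with algebraically closed
field of constants `C`, let `U ⊇ F` be a no-new-constants extension, and let
`x₁, …, x_l ∈ U` be algebraically independent antiderivatives of `F`.  For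
`i = 1, …, m` let `Aᵢ, Bᵢ, Cᵢ ∈ F[x₁,…,x_l]` be pairwise relatively prime
polynomials satisfying condition C1 (each `Cᵢ` irreducible, `Cᵢ ∤ Cⱼ` for `i ≠ j`,
and `Cᵢ ∤ Bⱼ` for all `i, j`), and let `y₁, …, yₘ ∈ U` satisfy
`yᵢ' = Aᵢ/(Cᵢ·Bᵢ)`.  Then `y₁, …, yₘ` are algebraically independent over
`F(x₁,…,x_l)`. -/
theorem jie_antiderivatives_algebraically_independent
    {U : Type*} [Field U] [CharZero U]
    (D : U → U) (hD : IsDerivation D)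
    (F : Subfield U) (hF : ∀ a ∈ F, D a ∈ F)
    (C : Subfield U) (hC : ∀ c : U, c ∈ C ↔ (c ∈ F ∧ D c = 0))
    [IsAlgClosed C]
    (hNNC : ∀ a : U, D a = 0 → a ∈ F)
    {l : ℕ} (x : Fin l → U) (hx : ∀ i, D (x i) ∈ F)
    (hind : AlgebraicIndependent F x)
    {m : ℕ} (A B Cp : Fin m → MvPolynomial (Fin l) F)
    (hAB : ∀ i, IsRelPrime (A i) (B i))
    (hAC : ∀ i, IsRelPrime (A i) (Cp i))
    (hBC : ∀ i, IsRelPrime (B i) (Cp i))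
    (hCirr : ∀ i, Irreducible (Cp i))
    (hCC : ∀ i j, i ≠ j → ¬ Cp i ∣ Cp j)
    (hCB : ∀ i j, ¬ Cp i ∣ B j)
    (y : Fin m → U)
    (hy : ∀ i, D (y i) =
      MvPolynomial.aeval x (A i) /
        (MvPolynomial.aeval x (Cp i) * MvPolynomial.aeval x (B i))) :
    AlgebraicIndependent (Subfield.closure (↑F ∪ Set.range x)) y := by
  classical
  let d : Derivation ℤ U U :=
    Derivation.mk' (AddMonoidHom.mk' D hD.map_add).toIntLinearMap (by
      intro a b
      change D (a * b) = a * D b + b * D a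
      rw [hD.leibniz]; ring)
  have hdD : ∀ a, d a = D a := fun a => rfl
  by_contra hdep
  set K := Subfield.closure (↑F ∪ Set.range x) with hK
  have hFK : ∀ a ∈ F, a ∈ K := fun a ha => Subfield.subset_closure (Or.inl ha)
  have hxK : ∀ i, x i ∈ K := fun i => Subfield.subset_closure (Or.inr ⟨i, rfl⟩)
  have hpK : ∀ P : MvPolynomial (Fin l) F, aeval x P ∈ K := by
    intro P
    induction P using MvPolynomial.induction_on with
    | C a => rw [aeval_C]; exact hFK _ a.2
    | add p q hp hq => rw [map_add]; exact K.add_mem hp hq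
    | mul_X p i hp => rw [map_mul, aeval_X]; exact K.mul_mem hp (hxK i)
  have hKd : ∀ a ∈ K, d a ∈ K := by
    intro a ha
    induction ha using Subfield.closure_induction with
    | mem a ha =>
      rcases ha with ha | ⟨i, rfl⟩
      · exact hFK _ (hF a ha)
      · exact hFK _ (hx i)
    | one => rw [Derivation.map_one_eq_zero]; exact K.zero_mem
    | add a b _ _ iha ihb => rw [map_add]; exact K.add_mem iha ihb
    | neg a _ iha => rw [map_neg]; exact K.neg_mem iha
    | inv a ha' iha =>
      rw [Derivation.leibniz_inv, smul_eq_mul]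
      exact K.mul_mem (K.neg_mem (K.pow_mem (K.inv_mem ha') 2)) iha
    | mul a b ha' hb' iha ihb =>
      rw [Derivation.leibniz, smul_eq_mul, smul_eq_mul]
      exact K.add_mem (K.mul_mem ha' ihb) (K.mul_mem hb' iha)
  have hyK : ∀ i, d (y i) ∈ K := by
    intro i
    rw [hdD, hy]
    exact K.div_mem (hpK _) (K.mul_mem (hpK _) (hpK _))
  obtain ⟨c, hc, ⟨i, hi⟩, g, hgK, hg⟩ := ostrowski_s14 d K hKd y hyK hdep
  obtain ⟨δ, h1, h2⟩ := exists_poly_deriv d F hF x (fun i => ⟨_, hx i⟩) (fun i => rfl)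
  have hnd := not_dvd_deriv d F hNNC x hind _ δ h1 h2 (Cp i) (hCirr i)
  have hsub : ∀ a ∈ Subring.closure (↑F ∪ Set.range x), ∃ P : MvPolynomial (Fin l) F,
      aeval x P = a := by
    intro a ha
    have hle : Subring.closure (↑F ∪ Set.range x) ≤
        (aeval x : MvPolynomial (Fin l) F →ₐ[F] U).toRingHom.range := by
      rw [Subring.closure_le]
      rintro a (ha | ⟨j, rfl⟩)
      · exact ⟨MvPolynomial.C ⟨a, ha⟩, aeval_C _ _⟩
      · exact ⟨X j, aeval_X _ _⟩
    exact hle ha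
  obtain ⟨a, ha, b, hb, hab⟩ := Subfield.mem_closure_iff.mp hgK
  obtain ⟨P₀, rfl⟩ := hsub a ha
  obtain ⟨Q₀, rfl⟩ := hsub b hb
  have hne : ∀ P : MvPolynomial (Fin l) F, P ≠ 0 → aeval x P ≠ 0 := fun P hP h0 =>
    hP (hind (by simpa using h0))
  have hB0 : ∀ j, aeval x (B j) ≠ 0 := fun j => hne _ (fun h0 => hCB j j (h0 ▸ dvd_zero _))
  have hC0 : ∀ j, aeval x (Cp j) ≠ 0 := fun j => hne _ (hCirr j).ne_zero
  have hpr : Prime (Cp i) := (hCirr i).prime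
  let e : Fin m → F := fun j => ⟨c j, hNNC _ (hc j)⟩
  let W : Fin m → MvPolynomial (Fin l) F := fun j =>
    ∏ k ∈ Finset.univ.erase j, (Cp k * B k)
  have hW : ∀ j, W j * (Cp j * B j) = ∏ k, (Cp k * B k) := fun j =>
    Finset.prod_erase_mul _ _ (Finset.mem_univ j)
  have hWi : ¬ Cp i ∣ W i := by
    intro h
    obtain ⟨k, hk, hk'⟩ := (hpr.dvd_finsetProd_iff _).mp h
    rcases hpr.dvd_or_dvd hk' with h | h
    · exact hCC i k (Finset.ne_of_mem_erase hk).symm h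
    · exact hCB i k h
  have hAi : ¬ Cp i ∣ A i := fun h => (hCirr i).not_isUnit (hAC i h dvd_rfl)
  refine no_simple_pole d F x hind δ h1 (Cp i) (hCirr i) hnd g P₀ Q₀ hab.symm
    (B i * W i) (∑ j, MvPolynomial.C (e j) * A j * W j) ?_ ?_ ?_
  · intro h
    rcases hpr.dvd_or_dvd h with h | h
    · exact hCB i i h
    · exact hWi h
  · intro h
    rw [← Finset.add_sum_erase _ _ (Finset.mem_univ i)] at h
    have h' : Cp i ∣ ∑ j ∈ Finset.univ.erase i, MvPolynomial.C (e j) * A j * W j := by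
      refine Finset.dvd_sum fun j hj => Dvd.dvd.mul_left ?_ _
      refine (dvd_mul_right (Cp i) (B i)).trans (Finset.dvd_prod_of_mem _ ?_)
      exact Finset.mem_erase.mpr ⟨(Finset.ne_of_mem_erase hj).symm, Finset.mem_univ _⟩
    rw [dvd_add_left h'] at h
    rcases hpr.dvd_or_dvd h with h | h
    · have hu : IsUnit (MvPolynomial.C (e i) : MvPolynomial (Fin l) F) := by
        refine IsUnit.map MvPolynomial.C (IsUnit.mk0 _ fun h0 => hi ?_)
        exact congrArg Subtype.val h0
      rw [hu.dvd_mul_left] at h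
      exact hAi h
    · exact hWi h
  · rw [← hg, ← map_mul, show B i * W i * Cp i = W i * (Cp i * B i) by ring, hW i,
      Finset.mul_sum, map_sum]
    refine Finset.sum_congr rfl fun j _ => ?_
    rw [hdD, hy j, ← hW j]
    simp only [map_mul, aeval_C]
    change _ = c j * _ * _
    have := hB0 j
    have := hC0 j
    field_simp
end
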